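/- Let β⃗ be sub-critical. There exists a constant c > 0 such that for all sufficiently large n, for every vector v ∈ [0,∞)^M, every f ∈ Lip(v), and every t ≥ 0, if X is distributed according to ERGM(β⃗) on 𝒢_n, then ℙ(|f(X) − 𝔼 f(X)| > t) ≤ 2 exp(−c t² / (‖v‖_1 ‖v‖_∞)). -/

import Mathlib

open Finset MeasureTheory Filter
open scoped ENNReal NNReal

namespace ERGM

/-- The set of edges of the complete graph on `Fin n`: non-diagonal unordered pairs. -/
abbrev EdgeSet (n : ℕ) : Type := {p : Sym2 (Fin n) // ¬ p.IsDiag}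

/-- A configuration (graph on `n` vertices): an assignment of `true/false` to each edge. -/
abbrev Config (n : ℕ) : Type := EdgeSet n → Bool

/-- The value of the configuration `x` on the (unordered) pair `{i,j}`; `false` for `i = j`. -/
noncomputable def edgeVal {n : ℕ} (x : Config n) (i j : Fin n) : Bool :=
  if h : (s(i, j) : Sym2 (Fin n)).IsDiag then false else x ⟨s(i, j), h⟩

/-- Real-valued indicator of presence of the edge `{i,j}` in `x`. -/
noncomputable def edgeInd {n : ℕ} (x : Config n) (i j : Fin n) : ℝ :=
  if edgeVal x i j = true then 1 else 0

open scoped Classical in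
/-- Subgraph counting number `N_G(x)`: the number of copies of `G` in `x` (times the
number of automorphisms), i.e. the sum over injective `ψ` of the product of edge
indicators (each edge indicator is idempotent, so counting ordered adjacent pairs
yields the same value as counting edges). -/
noncomputable def NG {n m : ℕ} (G : SimpleGraph (Fin m)) (x : Config n) : ℝ :=
  ∑ ψ : Fin m ↪ Fin n, ∏ a : Fin m, ∏ b : Fin m,
    if G.Adj a b then edgeInd x (ψ a) (ψ b) else 1

/-- The Hamiltonian `H(x) = Σ_i β_i N_{G_i}(x) / n^{|V_i|-2}`. -/
noncomputable def Hamiltonian {n s : ℕ} (V : Fin s → ℕ)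
    (G : ∀ i, SimpleGraph (Fin (V i))) (β : Fin s → ℝ) (x : Config n) : ℝ :=
  ∑ i, β i * NG (G i) x / (n : ℝ) ^ (V i - 2)

/-- The ERGM probability mass function `π(x) ∝ exp(H(x))`. -/
noncomputable def ergmProb {n s : ℕ} (V : Fin s → ℕ)
    (G : ∀ i, SimpleGraph (Fin (V i))) (β : Fin s → ℝ) (x : Config n) : ℝ :=
  Real.exp (Hamiltonian V G β x) / ∑ y : Config n, Real.exp (Hamiltonian V G β y)

/-- Expectation of `f` with respect to the mass function `w`. -/
noncomputable def expect {n : ℕ} (w : Config n → ℝ) (f : Config n → ℝ) : ℝ :=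
  ∑ x : Config n, w x * f x

open scoped Classical in
/-- Probability of the event `A` with respect to the mass function `w`. -/
noncomputable def prob {n : ℕ} (w : Config n → ℝ) (A : Config n → Prop) : ℝ :=
  ∑ x : Config n, if A x then w x else 0

/-- The number of edges `|E(G)|` of a finite graph. -/
noncomputable def numEdges {m : ℕ} (G : SimpleGraph (Fin m)) : ℕ := G.edgeSet.ncard

/-- `Ψ_β(p) = Σ_i 2 β_i |E_i| p^{|E_i|-1}`. -/
noncomputable def Psi {s : ℕ} (V : Fin s → ℕ) (G : ∀ i, SimpleGraph (Fin (V i)))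
    (β : Fin s → ℝ) (p : ℝ) : ℝ :=
  ∑ i, 2 * β i * (numEdges (G i) : ℝ) * p ^ (numEdges (G i) - 1)

/-- `Φ(u) = e^u / (1 + e^u)`. -/
noncomputable def Phi (u : ℝ) : ℝ := Real.exp u / (1 + Real.exp u)

/-- `φ_β(p) = Φ(Ψ_β(p))`. -/
noncomputable def phiFn {s : ℕ} (V : Fin s → ℕ) (G : ∀ i, SimpleGraph (Fin (V i)))
    (β : Fin s → ℝ) : ℝ → ℝ := fun p => Phi (Psi V G β p)

/-- `β` is sub-critical (high temperature) with fixed point `p`: `p` is the unique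
solution of `φ_β(p) = p` and it satisfies `φ_β'(p) < 1`. -/
def Subcritical {s : ℕ} (V : Fin s → ℕ) (G : ∀ i, SimpleGraph (Fin (V i)))
    (β : Fin s → ℝ) (p : ℝ) : Prop :=
  phiFn V G β p = p ∧ (∀ q : ℝ, phiFn V G β q = q → q = p) ∧
    deriv (phiFn V G β) p < 1

/-- The discrete derivative `∂_e H(x) = H(x_{e+}) - H(x_{e-})`. -/
noncomputable def dHam {n s : ℕ} (V : Fin s → ℕ) (G : ∀ i, SimpleGraph (Fin (V i)))
    (β : Fin s → ℝ) (e : EdgeSet n) (x : Config n) : ℝ :=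
  Hamiltonian V G β (Function.update x e true) - Hamiltonian V G β (Function.update x e false)

/-- Real-valued indicator `X_e` of presence of edge `e`. -/
noncomputable def edgeX {n : ℕ} (e : EdgeSet n) (x : Config n) : ℝ := if x e = true then 1 else 0

/-- Two edges of `K_n` share a vertex. -/
def ShareVertex {n : ℕ} (e f : EdgeSet n) : Prop := ∃ v : Fin n, v ∈ e.1 ∧ v ∈ f.1


/-- `f ∈ Lip(v)`: `|f(x) - f(y)| ≤ Σ_e v_e 1{x_e ≠ y_e}`. -/
def LipschitzVec {n : ℕ} (v : EdgeSet n → ℝ) (f : Config n → ℝ) : Prop :=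
  ∀ x y : Config n, |f x - f y| ≤ ∑ e : EdgeSet n, if x e ≠ y e then v e else 0

set_option linter.unusedSectionVars false

section HeatBath

variable {ι : Type*} [DecidableEq ι]

/-- The heat-bath operator resampling the coordinate `a` with success probability `q`. -/
def heat (q : (ι → Bool) → ℝ) (a : ι) : ((ι → Bool) → ℝ) →ₗ[ℝ] ((ι → Bool) → ℝ) where
  toFun F x := q x * F (Function.update x a true) + (1 - q x) * F (Function.update x a false)
  map_add' F G := by ext x; simp; ring
  map_smul' k F := by ext x; simp; ring

lemma heat_apply (q : (ι → Bool) → ℝ) (a : ι) (F : (ι → Bool) → ℝ) (x : ι → Bool) :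
    heat q a F x =
      q x * F (Function.update x a true) + (1 - q x) * F (Function.update x a false) := rfl

/-- The discrete derivative in the coordinate `a`. -/
def discDeriv (a : ι) (F : (ι → Bool) → ℝ) (x : ι → Bool) : ℝ :=
  F (Function.update x a true) - F (Function.update x a false)

/-- `q` does not depend on the coordinate `a`. -/
def Blind (a : ι) (q : (ι → Bool) → ℝ) : Prop :=
  ∀ x b, q (Function.update x a b) = q x

lemma Blind.heat {q : (ι → Bool) → ℝ} {a : ι} (hq : Blind a q) (F : (ι → Bool) → ℝ) :
    Blind a (heat q a F) := by
  intro x b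
  simp [heat_apply, hq x b]

lemma blind_const (a : ι) (s : ℝ) : Blind a fun _ : ι → Bool => s := fun _ _ => rfl

lemma heat_const {q : (ι → Bool) → ℝ} {a : ι} (k : ℝ) :
    heat q a (fun _ => k) = fun _ => k := by
  ext x; simp [heat_apply]; ring

variable [Fintype ι]

/-- Integration against a weight function, as a linear map. -/
def mean (w : (ι → Bool) → ℝ) : ((ι → Bool) → ℝ) →ₗ[ℝ] ℝ where
  toFun F := ∑ x, w x * F x
  map_add' F G := by simp [mul_add, sum_add_distrib]
  map_smul' k F := by simp [mul_sum, mul_left_comm]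

lemma mean_apply (w F : (ι → Bool) → ℝ) : mean w F = ∑ x, w x * F x := rfl

lemma mean_mono {w : (ι → Bool) → ℝ} (hw : ∀ x, 0 ≤ w x) {F F' : (ι → Bool) → ℝ}
    (h : ∀ x, F x ≤ F' x) : mean w F ≤ mean w F' :=
  sum_le_sum fun x _ => mul_le_mul_of_nonneg_left (h x) (hw x)

/-- Detailed balance of `w` for the heat-bath resampling of `a`. -/
def Balanced (w : (ι → Bool) → ℝ) (q : (ι → Bool) → ℝ) (a : ι) : Prop :=
  ∀ x, w (Function.update x a true) * (1 - q x) = w (Function.update x a false) * q x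

lemma two_mul_sum_eq_sum_update (a : ι) (A : (ι → Bool) → ℝ) :
    2 * ∑ x, A x =
      ∑ x, (A (Function.update x a true) + A (Function.update x a false)) := by
  let flip : (ι → Bool) → (ι → Bool) := fun x => Function.update x a (!x a)
  have hflip : Function.Involutive flip := by
    intro x
    simp [flip]
  have h := Equiv.sum_comp hflip.toPerm A
  rw [two_mul]
  nth_rewrite 2 [← h]
  rw [← sum_add_distrib]
  refine sum_congr rfl fun x _ => ?_
  have hx : Function.update x a (x a) = x := Function.update_eq_self a x
  simp only [Function.Involutive.coe_toPerm, flip]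
  cases hxa : x a <;> rw [hxa] at hx <;> simp [hx, add_comm]

lemma mean_heat {w q : (ι → Bool) → ℝ} {a : ι} (hw : Balanced w q a) (hq : Blind a q)
    (F : (ι → Bool) → ℝ) : mean w (heat q a F) = mean w F := by
  have h2 : (2 : ℝ) * mean w (heat q a F) = 2 * mean w F := by
    rw [mean_apply, mean_apply, two_mul_sum_eq_sum_update a, two_mul_sum_eq_sum_update a]
    refine sum_congr rfl fun x _ => ?_
    rw [hq.heat F x true, hq.heat F x false, heat_apply]
    have := hw x
    linear_combination (F (Function.update x a false) - F (Function.update x a true)) * this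
  linarith

lemma mean_sub_heat_mul {w q : (ι → Bool) → ℝ} {a : ι} (hw : Balanced w q a) (hq : Blind a q)
    (F F' : (ι → Bool) → ℝ) :
    mean w (fun x => (F x - heat q a F x) * F' x) =
      mean w (fun x => q x * (1 - q x) * discDeriv a F x * discDeriv a F' x) := by
  rw [← mean_heat hw hq (fun x => (F x - heat q a F x) * F' x)]
  congr 1
  ext x
  rw [heat_apply, hq.heat F x true, hq.heat F x false, heat_apply]
  unfold discDeriv
  ring

lemma abs_exp_sub_exp_le (u v : ℝ) :
    |Real.exp u - Real.exp v| ≤ |u - v| * (Real.exp u + Real.exp v) := by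
  wlog h : v ≤ u generalizing u v
  · rw [abs_sub_comm, abs_sub_comm u, add_comm]
    exact this v u (le_of_not_ge h)
  rw [abs_of_nonneg (sub_nonneg.2 (Real.exp_le_exp.2 h)), abs_of_nonneg (sub_nonneg.2 h)]
  have h1 : Real.exp v = Real.exp u * Real.exp (v - u) := by rw [← Real.exp_add]; ring_nf
  have h2 := Real.add_one_le_exp (v - u)
  have h3 := Real.exp_pos u
  have h4 := Real.exp_pos v
  nlinarith [mul_nonneg (sub_nonneg.2 h) h4.le]

lemma mean_poisson_exp_le {w q : (ι → Bool) → ℝ} {a : ι} (hw0 : ∀ x, 0 ≤ w x)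
    (hw : Balanced w q a) (hq : Blind a q) (hq0 : ∀ x, 0 ≤ q x) (hq1 : ∀ x, q x ≤ 1)
    {f g : (ι → Bool) → ℝ} {v L : ℝ} (hf : ∀ x, |discDeriv a f x| ≤ v)
    (hg : ∀ x, |discDeriv a g x| ≤ L) {θ : ℝ} (hθ : 0 ≤ θ) :
    mean w (fun x => (g x - heat q a g x) * Real.exp (θ * f x)) ≤
      θ * (v * L) * mean w (fun x => Real.exp (θ * f x)) := by
  rw [mean_sub_heat_mul hw hq, ← mean_heat hw hq (fun x => Real.exp (θ * f x)), ← smul_eq_mul,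
    ← map_smul]
  refine mean_mono hw0 fun x => ?_
  simp only [Pi.smul_apply, smul_eq_mul, heat_apply]
  set E1 := Real.exp (θ * f (Function.update x a true)) with hE1
  set E0 := Real.exp (θ * f (Function.update x a false)) with hE0
  have h1 : 0 < E1 := Real.exp_pos _
  have h0 : 0 < E0 := Real.exp_pos _
  have hqa := hq0 x
  have hqb := hq1 x
  have hE : |discDeriv a (fun x => Real.exp (θ * f x)) x| ≤ θ * v * (E1 + E0) := by
    refine (abs_exp_sub_exp_le _ _).trans ?_
    rw [← mul_sub, abs_mul, abs_of_nonneg hθ]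
    gcongr
    exact hf x
  have hv : 0 ≤ v := (abs_nonneg _).trans (hf x)
  have hL : 0 ≤ L := (abs_nonneg _).trans (hg x)
  have hqq : 0 ≤ q x * (1 - q x) := mul_nonneg hqa (by linarith)
  calc q x * (1 - q x) * discDeriv a g x * discDeriv a (fun x => Real.exp (θ * f x)) x
      ≤ q x * (1 - q x) * (|discDeriv a g x| * |discDeriv a (fun x => Real.exp (θ * f x)) x|) := by
        rw [mul_assoc, ← abs_mul]
        exact mul_le_mul_of_nonneg_left (le_abs_self _) hqq
    _ ≤ q x * (1 - q x) * (L * (θ * v * (E1 + E0))) := by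
        gcongr
        exact hg x
    _ = θ * (v * L) * (q x * (1 - q x) * (E1 + E0)) := by ring
    _ ≤ θ * (v * L) * (q x * E1 + (1 - q x) * E0) := by
        gcongr
        nlinarith [mul_nonneg (mul_nonneg hqa hqa) h1.le,
          mul_nonneg (mul_nonneg (sub_nonneg.2 hqb) (sub_nonneg.2 hqb)) h0.le]

/-- If `f` minus its mean is approximately `∑ a, (g a - P a (g a))` with control on the discrete
derivatives, then the moment generating function of `f` satisfies a Gaussian bound. -/
lemma mgf_le {w : (ι → Bool) → ℝ} {q : ι → (ι → Bool) → ℝ} (hw0 : ∀ x, 0 ≤ w x)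
    (hw1 : ∑ x, w x = 1) (hw : ∀ a, Balanced w (q a) a) (hq : ∀ a, Blind a (q a))
    (hq0 : ∀ a x, 0 ≤ q a x) (hq1 : ∀ a x, q a x ≤ 1)
    {f : (ι → Bool) → ℝ} {v L : ι → ℝ} (hf : ∀ a x, |discDeriv a f x| ≤ v a)
    (hdec : ∀ ε > 0, ∃ g : ι → (ι → Bool) → ℝ,
      (∀ x, |f x - mean w f - ∑ a, (g a x - heat (q a) a (g a) x)| ≤ ε) ∧
        ∀ a x, |discDeriv a (g a) x| ≤ L a)
    {B : ℝ} (hB : ∑ a, v a * L a ≤ B) {θ : ℝ} (hθ : 0 ≤ θ) :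
    mean w (fun x => Real.exp (θ * (f x - mean w f))) ≤ Real.exp (B * θ ^ 2 / 2) := by
  set μ := mean w f with hμ
  set m : ℝ → ℝ := fun θ => ∑ x, w x * Real.exp (θ * (f x - μ)) with hm
  have hm_pos : ∀ θ, 0 ≤ m θ := fun θ => sum_nonneg fun x _ =>
    mul_nonneg (hw0 x) (Real.exp_pos _).le
  have hderiv : ∀ θ, HasDerivAt m (∑ x, w x * ((f x - μ) * Real.exp (θ * (f x - μ)))) θ := by
    intro θ
    refine HasDerivAt.fun_sum fun x _ => ?_
    have := (((hasDerivAt_id θ).mul_const (f x - μ)).exp).const_mul (w x)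
    simpa [mul_comm] using this
  have hkey : ∀ θ, 0 ≤ θ → ∑ x, w x * ((f x - μ) * Real.exp (θ * (f x - μ))) ≤ B * θ * m θ := by
    intro θ hθ
    refine le_of_forall_pos_le_add fun ε hε => ?_
    have hε' : 0 < ε / (m θ + 1) := div_pos hε (by linarith [hm_pos θ])
    obtain ⟨g, hg1, hg2⟩ := hdec _ hε'
    have hstep : ∀ a, mean w (fun x => (g a x - heat (q a) a (g a) x) *
        Real.exp (θ * (f x - μ))) ≤ θ * (v a * L a) * m θ := by
      intro a
      refine mean_poisson_exp_le (f := fun x => f x - μ) hw0 (hw a) (hq a) (hq0 a) (hq1 a) ?_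
        (hg2 a) hθ
      intro x
      have := hf a x
      simpa [discDeriv] using this
    calc ∑ x, w x * ((f x - μ) * Real.exp (θ * (f x - μ)))
        ≤ ∑ x, (∑ a, w x * ((g a x - heat (q a) a (g a) x) * Real.exp (θ * (f x - μ))) +
            ε / (m θ + 1) * (w x * Real.exp (θ * (f x - μ)))) := by
          refine sum_le_sum fun x _ => ?_
          rw [← mul_sum, ← sum_mul]
          have h1 := (abs_le.1 (hg1 x)).2
          have h2 : 0 ≤ w x * Real.exp (θ * (f x - μ)) :=
            mul_nonneg (hw0 x) (Real.exp_pos _).le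
          nlinarith [mul_le_mul_of_nonneg_right h1 h2]
      _ = ∑ a, mean w (fun x => (g a x - heat (q a) a (g a) x) * Real.exp (θ * (f x - μ))) +
            ε / (m θ + 1) * m θ := by
          rw [sum_add_distrib, sum_comm, ← mul_sum]
          rfl
      _ ≤ ∑ a, θ * (v a * L a) * m θ + ε := by
          refine add_le_add (sum_le_sum fun a _ => hstep a) ?_
          rw [div_mul_eq_mul_div, div_le_iff₀ (by linarith [hm_pos θ])]
          nlinarith [hm_pos θ]
      _ = θ * (∑ a, v a * L a) * m θ + ε := by
          rw [← sum_mul, ← mul_sum]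
      _ ≤ B * θ * m θ + ε := by
          have := mul_le_mul_of_nonneg_right (mul_le_mul_of_nonneg_left hB hθ) (hm_pos θ)
          linarith
  set ψ : ℝ → ℝ := fun θ => m θ * Real.exp (-(B * θ ^ 2 / 2)) with hψ
  have hψd : ∀ θ, HasDerivAt ψ ((∑ x, w x * ((f x - μ) * Real.exp (θ * (f x - μ))) - B * θ * m θ) *
      Real.exp (-(B * θ ^ 2 / 2))) θ := by
    intro θ
    have h1 : HasDerivAt (fun θ : ℝ => -(B * θ ^ 2 / 2)) (-(B * θ)) θ := by
      have := (((hasDerivAt_pow 2 θ).const_mul B).div_const 2).neg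
      refine this.congr_deriv ?_
      push_cast
      ring
    refine ((hderiv θ).mul h1.exp).congr_deriv ?_
    ring
  have hanti : AntitoneOn ψ (Set.Ici 0) := by
    refine antitoneOn_of_deriv_nonpos (convex_Ici 0)
      (fun θ _ => (hψd θ).continuousAt.continuousWithinAt)
      (fun θ _ => (hψd θ).differentiableAt.differentiableWithinAt) fun θ hθ => ?_
    rw [(hψd θ).deriv]
    rw [interior_Ici] at hθ
    exact mul_nonpos_of_nonpos_of_nonneg (sub_nonpos.2 (hkey θ (le_of_lt hθ))) (Real.exp_pos _).le
  have h0 := hanti (Set.mem_Ici.2 le_rfl) (Set.mem_Ici.2 hθ) hθ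
  have hψ0 : ψ 0 = 1 := by simp [hψ, hm, hw1]
  rw [hψ0] at h0
  have h3 : m θ * Real.exp (-(B * θ ^ 2 / 2)) ≤ 1 := h0
  rw [Real.exp_neg, ← div_eq_mul_inv, div_le_one (Real.exp_pos _)] at h3
  exact h3

open scoped Classical in
/-- The real-valued indicator of an event. -/
noncomputable def ind (A : (ι → Bool) → Prop) (x : ι → Bool) : ℝ := if A x then 1 else 0

lemma tail_le {w : (ι → Bool) → ℝ} {q : ι → (ι → Bool) → ℝ} (hw0 : ∀ x, 0 ≤ w x)
    (hw1 : ∑ x, w x = 1) (hw : ∀ a, Balanced w (q a) a) (hq : ∀ a, Blind a (q a))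
    (hq0 : ∀ a x, 0 ≤ q a x) (hq1 : ∀ a x, q a x ≤ 1)
    {f : (ι → Bool) → ℝ} {v L : ι → ℝ} (hf : ∀ a x, |discDeriv a f x| ≤ v a)
    (hdec : ∀ ε > 0, ∃ g : ι → (ι → Bool) → ℝ,
      (∀ x, |f x - mean w f - ∑ a, (g a x - heat (q a) a (g a) x)| ≤ ε) ∧
        ∀ a x, |discDeriv a (g a) x| ≤ L a)
    {B : ℝ} (hB0 : 0 < B) (hB : ∑ a, v a * L a ≤ B) {t : ℝ} (ht : 0 ≤ t) :
    mean w (ind fun x => t < f x - mean w f) ≤ Real.exp (-(t ^ 2 / (2 * B))) := by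
  have hθ : 0 ≤ t / B := div_nonneg ht hB0.le
  have h := mgf_le hw0 hw1 hw hq hq0 hq1 hf hdec hB hθ
  have h1 : Real.exp (t / B * t) * mean w (ind fun x => t < f x - mean w f) ≤
      mean w (fun x => Real.exp (t / B * (f x - mean w f))) := by
    rw [← smul_eq_mul, ← map_smul]
    refine mean_mono hw0 fun x => ?_
    simp only [Pi.smul_apply, smul_eq_mul, ind]
    split_ifs with hx
    · rw [mul_one]
      exact Real.exp_le_exp.2 (mul_le_mul_of_nonneg_left hx.le hθ)
    · rw [mul_zero]
      exact (Real.exp_pos _).le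
  have h2 := h1.trans h
  rw [mul_comm, ← le_div_iff₀ (Real.exp_pos _), ← Real.exp_sub] at h2
  refine h2.trans (le_of_eq ?_)
  congr 1
  field_simp
  ring

end HeatBath

section Bernoulli

variable {ι : Type*} [DecidableEq ι]

lemma ind_nonneg (A : (ι → Bool) → Prop) (x : ι → Bool) : 0 ≤ ind A x := by
  unfold ind; split_ifs <;> norm_num

lemma ind_le_one (A : (ι → Bool) → Prop) (x : ι → Bool) : ind A x ≤ 1 := by
  unfold ind; split_ifs <;> norm_num

lemma ind_mono {A A' : (ι → Bool) → Prop} {x y : ι → Bool} (h : A x → A' y) :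
    ind A x ≤ ind A' y := by
  by_cases hA : A x
  · simp [ind, hA, h hA]
  · simpa [ind, hA] using ind_nonneg A' y

lemma Blind.heat_of_blind {q F : (ι → Bool) → ℝ} {a e : ι} (hq : Blind e q) (hF : Blind e F) :
    Blind e (ERGM.heat q a F) := by
  intro x b
  by_cases hae : a = e
  · subst hae
    exact hq.heat F x b
  · rw [heat_apply, heat_apply, hq, Function.update_comm (Ne.symm hae), hF,
      Function.update_comm (Ne.symm hae), hF]

lemma discDeriv_heat_const {s : ℝ} {a e : ι} (hae : a ≠ e) (F : (ι → Bool) → ℝ) (x : ι → Bool) :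
    discDeriv e (heat (fun _ => s) a F) x =
      heat (fun _ => s) a (discDeriv e F) x := by
  simp only [discDeriv, heat_apply, Function.update_comm hae]
  ring

lemma discDeriv_eq_zero {a : ι} {F : (ι → Bool) → ℝ} (h : Blind a F) (x : ι → Bool) :
    discDeriv a F x = 0 := by
  simp [discDeriv, h x]

lemma abs_heat_le {q F : (ι → Bool) → ℝ} {a : ι} {x : ι → Bool} (h0 : 0 ≤ q x) (h1 : q x ≤ 1)
    {v : ℝ} (hF : ∀ x, |F x| ≤ v) : |heat q a F x| ≤ v := by
  rw [heat_apply]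
  refine (abs_add_le _ _).trans ?_
  rw [abs_mul, abs_mul, abs_of_nonneg h0, abs_of_nonneg (sub_nonneg.2 h1)]
  nlinarith [mul_le_mul_of_nonneg_left (hF (Function.update x a true)) h0,
    mul_le_mul_of_nonneg_left (hF (Function.update x a false)) (sub_nonneg.2 h1)]

variable [Fintype ι]

/-- The weight function of the product Bernoulli measure with parameters `r`. -/
def bern (r : ι → ℝ) (x : ι → Bool) : ℝ := ∏ a, if x a = true then r a else 1 - r a

lemma bern_nonneg {r : ι → ℝ} (h0 : ∀ a, 0 ≤ r a) (h1 : ∀ a, r a ≤ 1) (x : ι → Bool) :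
    0 ≤ bern r x :=
  prod_nonneg fun a _ => by
    split_ifs
    · exact h0 a
    · exact sub_nonneg.2 (h1 a)

lemma bern_update (r : ι → ℝ) (x : ι → Bool) (a : ι) (b : Bool) :
    bern r (Function.update x a b) =
      (if b = true then r a else 1 - r a) *
        ∏ e ∈ univ.erase a, if x e = true then r e else 1 - r e := by
  unfold bern
  rw [← mul_prod_erase univ _ (mem_univ a), Function.update_self]
  congr 1
  refine prod_congr rfl fun e he => ?_
  rw [Function.update_of_ne (ne_of_mem_erase he)]

lemma sum_prod_bool (g : ι → Bool → ℝ) :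
    ∑ x : ι → Bool, ∏ a, g a (x a) = ∏ a, (g a true + g a false) := by
  have h := prod_univ_sum (fun _ : ι => (univ : Finset Bool)) g
  rw [Fintype.piFinset_univ] at h
  rw [← h]
  simp

lemma mean_bern_ind_subset (r : ι → ℝ) (S : Finset ι) :
    mean (bern r) (ind fun x => ∀ c ∈ S, x c = true) = ∏ c ∈ S, r c := by
  have h := sum_prod_bool
    (fun a b => if b = true then r a else if a ∈ S then 0 else 1 - r a)
  rw [mean_apply]
  calc _ = ∑ x : ι → Bool, ∏ a, (if x a = true then r a else if a ∈ S then 0 else 1 - r a) := by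
        refine sum_congr rfl fun x _ => ?_
        by_cases hx : ∀ c ∈ S, x c = true
        · rw [ind, if_pos hx, mul_one]
          refine prod_congr rfl fun a _ => ?_
          by_cases ha : a ∈ S
          · simp [hx a ha]
          · simp [ha]
        · rw [ind, if_neg hx, mul_zero]
          push Not at hx
          obtain ⟨c, hc, hxc⟩ := hx
          exact (prod_eq_zero (mem_univ c) (by simp [hc, hxc])).symm
    _ = ∏ a, if a ∈ S then r a else 1 := by
        rw [h]
        refine prod_congr rfl fun a _ => ?_
        by_cases ha : a ∈ S <;> simp [ha]
    _ = _ := by simp [prod_ite_mem]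

lemma sum_bern (r : ι → ℝ) : ∑ x, bern r x = 1 := by
  have := mean_bern_ind_subset r ∅
  simpa [mean_apply, ind] using this

lemma mean_bern_const (r : ι → ℝ) (k : ℝ) : mean (bern r) (fun _ => k) = k := by
  rw [mean_apply, ← sum_mul, sum_bern, one_mul]

lemma balanced_bern (r : ι → ℝ) (a : ι) : Balanced (bern r) (fun _ => r a) a := by
  intro x
  rw [bern_update, bern_update]
  simp
  ring

lemma mean_bern_heat (r : ι → ℝ) (a : ι) (s : ℝ) (F : (ι → Bool) → ℝ) :
    mean (bern r) (heat (fun _ => s) a F) = mean (bern (Function.update r a s)) F := by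
  have hbal : Balanced (bern (Function.update r a s)) (fun _ => s) a := by
    simpa using balanced_bern (Function.update r a s) a
  rw [← mean_heat hbal (blind_const a s) F]
  have h2 : (2 : ℝ) * mean (bern r) (heat (fun _ => s) a F) =
      2 * mean (bern (Function.update r a s)) (heat (fun _ => s) a F) := by
    rw [mean_apply, mean_apply, two_mul_sum_eq_sum_update a, two_mul_sum_eq_sum_update a]
    refine sum_congr rfl fun x _ => ?_
    rw [(blind_const a s).heat F x true, (blind_const a s).heat F x false]
    simp only [bern_update, Function.update_self]
    have : ∏ e ∈ univ.erase a, (if x e = true then Function.update r a s e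
        else 1 - Function.update r a s e) =
        ∏ e ∈ univ.erase a, if x e = true then r e else 1 - r e := by
      refine prod_congr rfl fun e he => ?_
      rw [Function.update_of_ne (ne_of_mem_erase he)]
    rw [this]
    simp
    ring
  linarith

lemma eq_of_forall_blind {F : (ι → Bool) → ℝ} (h : ∀ a, Blind a F) (x y : ι → Bool) :
    F x = F y := by
  have : ∀ s : Finset ι, F (s.piecewise x y) = F y := by
    intro s
    induction s using Finset.induction_on with
    | empty => simp
    | insert a s ha ih => rw [piecewise_insert, h a, ih]
  simpa using this univ

lemma exists_poisson_const {r : ι → ℝ} (h0 : ∀ a, 0 ≤ r a) (h1 : ∀ a, r a ≤ 1)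
    {f : (ι → Bool) → ℝ} {v : ι → ℝ} (hf : ∀ a x, |discDeriv a f x| ≤ v a) (s : Finset ι) :
    ∃ (g : ι → (ι → Bool) → ℝ) (F : (ι → Bool) → ℝ),
      (∀ x, f x - F x = ∑ a ∈ s, (g a x - heat (fun _ => r a) a (g a) x)) ∧
      (∀ a x, |discDeriv a (g a) x| ≤ v a) ∧ (∀ a x, |discDeriv a F x| ≤ v a) ∧
      ∀ a ∈ s, Blind a F := by
  induction s using Finset.induction_on with
  | empty => exact ⟨fun _ => f, f, by simp, hf, hf, by simp⟩
  | insert a s ha ih =>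
    obtain ⟨g, F, hg, hgv, hFv, hFb⟩ := ih
    refine ⟨Function.update g a F, heat (fun _ => r a) a F, fun x => ?_, fun e x => ?_,
      fun e x => ?_, fun e he => ?_⟩
    · rw [sum_insert ha, Function.update_self]
      have : ∑ e ∈ s, (Function.update g a F e x -
          heat (fun _ => r e) e (Function.update g a F e) x) =
          ∑ e ∈ s, (g e x - heat (fun _ => r e) e (g e) x) := by
        refine sum_congr rfl fun e he => ?_
        rw [Function.update_of_ne (ne_of_mem_of_not_mem he ha)]
      rw [this, ← hg]
      ring
    · by_cases hea : e = a
      · subst hea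
        simpa using hFv e x
      · simpa [hea] using hgv e x
    · by_cases hea : a = e
      · subst hea
        rw [discDeriv_eq_zero ((blind_const a (r a)).heat F), abs_zero]
        exact (abs_nonneg _).trans (hf a x)
      · rw [discDeriv_heat_const hea]
        exact abs_heat_le (h0 a) (h1 a) (hFv e)
    · rcases mem_insert.1 he with rfl | he
      · exact (blind_const _ _).heat F
      · exact (blind_const _ _).heat_of_blind (hFb e he)

/-- McDiarmid's inequality for product Bernoulli measures. -/
lemma bern_tail_le {r : ι → ℝ} (h0 : ∀ a, 0 ≤ r a) (h1 : ∀ a, r a ≤ 1)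
    {f : (ι → Bool) → ℝ} {v : ι → ℝ} (hf : ∀ a x, |discDeriv a f x| ≤ v a)
    {B : ℝ} (hB0 : 0 < B) (hB : ∑ a, v a ^ 2 ≤ B) {t : ℝ} (ht : 0 ≤ t) :
    mean (bern r) (ind fun x => t < f x - mean (bern r) f) ≤ Real.exp (-(t ^ 2 / (2 * B))) := by
  refine tail_le (q := fun a _ => r a) (v := v) (L := v) (bern_nonneg h0 h1) (sum_bern r)
    (balanced_bern r) (fun a => blind_const a (r a)) (fun a _ => h0 a) (fun a _ => h1 a) hf
    (fun ε hε => ?_) hB0 (by simpa [sq] using hB) ht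
  obtain ⟨g, F, hg, hgv, -, hFb⟩ := exists_poisson_const h0 h1 hf univ
  refine ⟨g, fun x => ?_, hgv⟩
  have hconst : ∀ y, F y = F x := fun y => eq_of_forall_blind (fun a => hFb a (mem_univ a)) y x
  have hF : F = fun _ => F x := funext hconst
  have hmean : mean (bern r) f = F x := by
    have h2 : f = F + ∑ a, (g a - heat (fun _ => r a) a (g a)) := by
      ext y
      simp only [Pi.add_apply, Finset.sum_apply, Pi.sub_apply, ← hg y]
      ring
    rw [h2, map_add, map_sum, hF, mean_bern_const]
    simp only [add_eq_left]
    refine sum_eq_zero fun a _ => ?_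
    rw [map_sub, mean_heat (balanced_bern r a) (blind_const a (r a)), sub_self]
  rw [hmean, hg x, sub_self, abs_zero]
  exact hε.le

end Bernoulli

section Dynamics

variable {ι : Type*} [DecidableEq ι] [Fintype ι]

/-- Monotone (attractive) heat-bath rates. -/
structure Rates (q : ι → (ι → Bool) → ℝ) : Prop where
  nonneg : ∀ a x, 0 ≤ q a x
  le_one : ∀ a x, q a x ≤ 1
  mono : ∀ a, Monotone (q a)
  blind : ∀ a, Blind a (q a)

/-- Weights of a step: with probability `c a` the coordinate `a` is resampled, and nothing happens
with the remaining probability. -/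
structure Admissible (c : ι → ℝ) : Prop where
  nonneg : ∀ a, 0 ≤ c a
  sum_le : ∑ a, c a ≤ 1

/-- The transition operator of a step with weights `c`. -/
def step (q : ι → (ι → Bool) → ℝ) (c : ι → ℝ) : Module.End ℝ ((ι → Bool) → ℝ) :=
  1 + ∑ a, c a • (heat (q a) a - 1)

lemma step_apply (q : ι → (ι → Bool) → ℝ) (c : ι → ℝ) (F : (ι → Bool) → ℝ) (x : ι → Bool) :
    step q c F x = F x + ∑ a, c a * (heat (q a) a F x - F x) := by
  simp [step, LinearMap.sum_apply, Finset.sum_apply]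

/-- The transition operator of a list of steps, the head of the list being performed first. -/
def op (q : ι → (ι → Bool) → ℝ) (l : List (ι → ℝ)) : Module.End ℝ ((ι → Bool) → ℝ) :=
  (l.map (step q)).prod

variable {q : ι → (ι → Bool) → ℝ}

lemma op_nil (F : (ι → Bool) → ℝ) : op q [] F = F := by simp [op]

lemma op_cons (c : ι → ℝ) (l : List (ι → ℝ)) (F : (ι → Bool) → ℝ) :
    op q (c :: l) F = step q c (op q l F) := by simp [op]

lemma op_append (l l' : List (ι → ℝ)) (F : (ι → Bool) → ℝ) :
    op q (l ++ l') F = op q l (op q l' F) := by simp [op]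

lemma step_eq (c : ι → ℝ) (F : (ι → Bool) → ℝ) (x : ι → Bool) :
    step q c F x = (1 - ∑ a, c a) * F x + ∑ a, c a * heat (q a) a F x := by
  rw [step_apply]
  simp only [mul_sub, sum_sub_distrib, ← sum_mul]
  ring

lemma heat_rel (hq : Rates q) (a : ι) {F F' : (ι → Bool) → ℝ}
    (h : ∀ x y, x ≤ y → F y ≤ F' x) {x y : ι → Bool} (hxy : x ≤ y) :
    heat (q a) a F y ≤ heat (q a) a F' x := by
  have h0 := hq.nonneg a x
  have h1 := hq.le_one a y
  have h2 := hq.mono a hxy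
  have up : ∀ b b' : Bool, b ≤ b' → Function.update x a b ≤ Function.update y a b' :=
    fun b b' hb => update_le_update_iff.2 ⟨hb, fun j _ => hxy j⟩
  have e1 := h _ _ (up true true le_rfl)
  have e2 := h _ _ (up false true (by decide))
  have e3 := h _ _ (up false false le_rfl)
  rw [heat_apply, heat_apply]
  nlinarith [mul_le_mul_of_nonneg_left e1 h0, mul_le_mul_of_nonneg_left e2 (sub_nonneg.2 h2),
    mul_le_mul_of_nonneg_left e3 (sub_nonneg.2 h1)]

lemma step_rel (hq : Rates q) {c : ι → ℝ} (hc : Admissible c) {F F' : (ι → Bool) → ℝ}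
    (h : ∀ x y, x ≤ y → F y ≤ F' x) {x y : ι → Bool} (hxy : x ≤ y) :
    step q c F y ≤ step q c F' x := by
  rw [step_eq, step_eq]
  refine add_le_add (mul_le_mul_of_nonneg_left (h x y hxy) (sub_nonneg.2 hc.sum_le))
    (sum_le_sum fun a _ => mul_le_mul_of_nonneg_left (heat_rel hq a h hxy) (hc.nonneg a))

lemma op_rel (hq : Rates q) {l : List (ι → ℝ)} (hl : ∀ c ∈ l, Admissible c)
    {F F' : (ι → Bool) → ℝ} (h : ∀ x y, x ≤ y → F y ≤ F' x) {x y : ι → Bool} (hxy : x ≤ y) :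
    op q l F y ≤ op q l F' x := by
  induction l generalizing x y with
  | nil => simpa [op_nil] using h x y hxy
  | cons c l ih =>
    rw [op_cons, op_cons]
    exact step_rel hq (hl c (by simp))
      (fun x y hxy => ih (fun c hc => hl c (by simp [hc])) hxy) hxy

lemma heat_le (hq : Rates q) (a : ι) {F F' : (ι → Bool) → ℝ} (h : ∀ x, F x ≤ F' x)
    (x : ι → Bool) : heat (q a) a F x ≤ heat (q a) a F' x :=
  add_le_add (mul_le_mul_of_nonneg_left (h _) (hq.nonneg a x))
    (mul_le_mul_of_nonneg_left (h _) (sub_nonneg.2 (hq.le_one a x)))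

lemma step_le (hq : Rates q) {c : ι → ℝ} (hc : Admissible c) {F F' : (ι → Bool) → ℝ}
    (h : ∀ x, F x ≤ F' x) (x : ι → Bool) : step q c F x ≤ step q c F' x := by
  rw [step_eq, step_eq]
  exact add_le_add (mul_le_mul_of_nonneg_left (h x) (sub_nonneg.2 hc.sum_le))
    (sum_le_sum fun a _ => mul_le_mul_of_nonneg_left (heat_le hq a h x) (hc.nonneg a))

lemma op_le (hq : Rates q) {l : List (ι → ℝ)} (hl : ∀ c ∈ l, Admissible c)
    {F F' : (ι → Bool) → ℝ} (h : ∀ x, F x ≤ F' x) (x : ι → Bool) :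
    op q l F x ≤ op q l F' x := by
  induction l generalizing x with
  | nil => simpa [op_nil] using h x
  | cons c l ih =>
    rw [op_cons, op_cons]
    exact step_le hq (hl c (by simp)) (ih fun c hc => hl c (by simp [hc])) x

lemma op_const (l : List (ι → ℝ)) (k : ℝ) : op q l (fun _ => k) = fun _ => k := by
  induction l with
  | nil => exact op_nil _
  | cons c l ih =>
    rw [op_cons, ih]
    ext x
    simp [step_apply, heat_const]

lemma mean_op (hq : Rates q) {w : (ι → Bool) → ℝ} (hw : ∀ a, Balanced w (q a) a)
    (l : List (ι → ℝ)) (F : (ι → Bool) → ℝ) : mean w (op q l F) = mean w F := by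
  induction l with
  | nil => rw [op_nil]
  | cons c l ih =>
    rw [op_cons, ← ih]
    simp [step, LinearMap.sum_apply, mean_heat (hw _) (hq.blind _)]

/-- The increments of `F` along the order are bounded by those of `F'`. -/
def IncLe (F F' : (ι → Bool) → ℝ) : Prop := ∀ x y, x ≤ y → F y - F x ≤ F' y - F' x

lemma IncLe.trans {F F' F'' : (ι → Bool) → ℝ} (h : IncLe F F') (h' : IncLe F' F'') :
    IncLe F F'' := fun x y hxy => (h x y hxy).trans (h' x y hxy)

lemma IncLe.op (hq : Rates q) {l : List (ι → ℝ)} (hl : ∀ c ∈ l, Admissible c)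
    {F F' : (ι → Bool) → ℝ} (h : IncLe F F') : IncLe (op q l F) (op q l F') := by
  intro x y hxy
  have := op_rel hq hl (F := F - F') (F' := F - F')
    (fun x y hxy => by have := h x y hxy; simp only [Pi.sub_apply]; linarith) hxy
  simp only [map_sub, Pi.sub_apply] at this
  linarith

lemma IncLe.smul {F F' : (ι → Bool) → ℝ} (h : IncLe F F') {d : ℝ} (hd : 0 ≤ d) :
    IncLe (d • F) (d • F') := fun x y hxy => by
  simp only [Pi.smul_apply, smul_eq_mul, ← mul_sub]
  exact mul_le_mul_of_nonneg_left (h x y hxy) hd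

/-- The value of a coordinate as a real number. -/
def coord (e : ι) (x : ι → Bool) : ℝ := if x e = true then 1 else 0

lemma coord_mono (e : ι) {x y : ι → Bool} (h : x ≤ y) : coord e x ≤ coord e y := by
  have := h e
  unfold coord
  cases hx : x e <;> cases hy : y e <;> rw [hx, hy] at this <;>
    first | exact absurd (this rfl) (by simp) | norm_num

lemma coord_nonneg (e : ι) (x : ι → Bool) : 0 ≤ coord e x := by
  unfold coord; split_ifs <;> norm_num

lemma coord_le_one (e : ι) (x : ι → Bool) : coord e x ≤ 1 := by
  unfold coord; split_ifs <;> norm_num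

/-- The linear function with coefficients `w`. -/
def lin (w : ι → ℝ) (x : ι → Bool) : ℝ := ∑ e, w e * coord e x

/-- The number of coordinates equal to `true`. -/
def total : (ι → Bool) → ℝ := lin fun _ => 1

lemma total_apply (x : ι → Bool) : total x = ∑ e, coord e x := by simp [total, lin]

lemma lin_update (w : ι → ℝ) (a : ι) (b : Bool) (x : ι → Bool) :
    lin w (Function.update x a b) = lin w x + w a * ((if b = true then 1 else 0) - coord a x) := by
  unfold lin
  rw [← add_sum_erase univ _ (mem_univ a),
    ← add_sum_erase univ (fun e => w e * coord e x) (mem_univ a)]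
  have : ∑ e ∈ univ.erase a, w e * coord e (Function.update x a b) =
      ∑ e ∈ univ.erase a, w e * coord e x := by
    refine sum_congr rfl fun e he => ?_
    rw [coord, Function.update_of_ne (ne_of_mem_erase he), coord]
  rw [this, coord, Function.update_self]
  ring

lemma heat_lin (p : (ι → Bool) → ℝ) (w : ι → ℝ) (a : ι) (x : ι → Bool) :
    heat p a (lin w) x = lin w x + w a * (p x - coord a x) := by
  rw [heat_apply, lin_update, lin_update]
  simp
  ring

lemma step_lin (c w : ι → ℝ) (x : ι → Bool) :
    step q c (lin w) x = lin w x + ∑ a, c a * (w a * (q a x - coord a x)) := by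
  rw [step_apply]
  simp [heat_lin]

/-- `J` bounds the influence of the coordinates on the rates. -/
structure Influence (q : ι → (ι → Bool) → ℝ) (J : ι → ι → ℝ) (K : ℝ) : Prop where
  nonneg : ∀ a e, 0 ≤ J a e
  incr : ∀ a x y, x ≤ y → q a y - q a x ≤ ∑ e, J a e * (coord e y - coord e x)
  colSum : ∀ e, ∑ a, J a e ≤ K

/-- The total weight with which a coordinate is resampled in a list of steps. -/
def load (l : List (ι → ℝ)) (a : ι) : ℝ := (l.map fun c => c a).sum

lemma load_nonneg {l : List (ι → ℝ)} (hl : ∀ c ∈ l, Admissible c) (a : ι) : 0 ≤ load l a :=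
  List.sum_nonneg fun r hr => by
    obtain ⟨c, hc, rfl⟩ := List.mem_map.1 hr
    exact (hl c hc).nonneg a

lemma load_cons (c : ι → ℝ) (l : List (ι → ℝ)) (a : ι) : load (c :: l) a = c a + load l a := by
  simp [load]

lemma op_total_incLe_lin (hq : Rates q) {J : ι → ι → ℝ} {K : ℝ} (hJ : Influence q J K) {η : ℝ}
    (hηK : η * K ≤ 1 / 2) {l : List (ι → ℝ)} (hl : ∀ c ∈ l, Admissible c)
    (hload : ∀ a, load l a ≤ η) :
    IncLe (op q l total) (lin fun e => 1 + 2 * ∑ a, load l a * J a e) ∧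
      ∀ e, 1 + 2 * ∑ a, load l a * J a e ≤ 2 := by
  have hbound : ∀ l : List (ι → ℝ), (∀ a, load l a ≤ η) → (∀ c ∈ l, Admissible c) →
      ∀ e, 1 + 2 * ∑ a, load l a * J a e ≤ 2 := by
    intro l hload hl e
    have h1 : ∑ a, load l a * J a e ≤ η * ∑ a, J a e := by
      rw [mul_sum]
      exact sum_le_sum fun a _ => mul_le_mul_of_nonneg_right (hload a) (hJ.nonneg a e)
    have hη : 0 ≤ η := (load_nonneg hl e).trans (hload e)
    have := mul_le_mul_of_nonneg_left (hJ.colSum e) hη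
    linarith
  refine ⟨?_, hbound l hload hl⟩
  induction l with
  | nil =>
    intro x y _
    simp [op_nil, load, total]
  | cons c l ih =>
    have hl' : ∀ c ∈ l, Admissible c := fun c hc => hl c (by simp [hc])
    have hc := hl c (by simp)
    have hload' : ∀ a, load l a ≤ η := fun a => by
      have := hload a
      rw [load_cons] at this
      have := hc.nonneg a
      linarith
    have hb := hbound l hload' hl'
    have h1 := (ih hl' hload').op hq (l := [c]) (by simpa using hc)
    rw [← op_append] at h1
    refine h1.trans fun x y hxy => ?_
    simp only [op_cons, op_nil, step_lin]
    set w : ι → ℝ := fun e => 1 + 2 * ∑ a, load l a * J a e with hw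
    have hw0 : ∀ a, 0 ≤ w a := fun a => by
      have : 0 ≤ ∑ b, load l b * J b a :=
        sum_nonneg fun b _ => mul_nonneg (load_nonneg hl' b) (hJ.nonneg b a)
      simp only [hw]; linarith
    have hterm : ∀ a, c a * (w a * (q a y - coord a y)) - c a * (w a * (q a x - coord a x)) ≤
        ∑ e, 2 * (c a * J a e) * (coord e y - coord e x) := by
      intro a
      have hi := hJ.incr a x y hxy
      have hm := coord_mono a hxy
      have hcw : 0 ≤ c a * w a := mul_nonneg (hc.nonneg a) (hw0 a)
      have hs : 0 ≤ ∑ e, J a e * (coord e y - coord e x) := sum_nonneg fun e _ =>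
        mul_nonneg (hJ.nonneg a e) (sub_nonneg.2 (coord_mono e hxy))
      calc _ = c a * w a * (q a y - q a x) - c a * w a * (coord a y - coord a x) := by ring
        _ ≤ c a * w a * ∑ e, J a e * (coord e y - coord e x) := by
            have := mul_le_mul_of_nonneg_left hi hcw
            have := mul_nonneg hcw (sub_nonneg.2 hm)
            linarith
        _ ≤ c a * 2 * ∑ e, J a e * (coord e y - coord e x) := by
            have := mul_le_mul_of_nonneg_left (hb a) (hc.nonneg a)
            exact mul_le_mul_of_nonneg_right this hs
        _ = _ := by
            rw [mul_sum]
            exact sum_congr rfl fun e _ => by ring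
    have hsum := sum_le_sum fun a (_ : a ∈ univ) => hterm a
    rw [sum_sub_distrib, sum_comm] at hsum
    have hfin : lin (fun e => 1 + 2 * ∑ a, load (c :: l) a * J a e) y -
        lin (fun e => 1 + 2 * ∑ a, load (c :: l) a * J a e) x =
        lin w y - lin w x + ∑ e, ∑ a, 2 * (c a * J a e) * (coord e y - coord e x) := by
      simp only [lin, ← sum_sub_distrib, ← sum_add_distrib]
      refine sum_congr rfl fun e _ => ?_
      rw [← sum_mul, ← mul_sum]
      simp only [hw, load_cons, add_mul, sum_add_distrib]
      ring
    rw [hfin]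
    linarith

/-- `f` changes by at most `d` times the number of changed coordinates. -/
def LipC (d : ℝ) (f : (ι → Bool) → ℝ) : Prop := IncLe f (d • total) ∧ IncLe (-f) (d • total)

lemma total_update_sub (a : ι) (x : ι → Bool) :
    total (Function.update x a true) - total (Function.update x a false) = 1 := by
  simp [total, lin_update]

lemma update_false_le_update_true (a : ι) (x : ι → Bool) :
    Function.update x a false ≤ Function.update x a true :=
  update_le_update_iff.2 ⟨by decide, fun _ _ => le_rfl⟩

lemma LipC.abs_discDeriv_le {d : ℝ} {f : (ι → Bool) → ℝ} (h : LipC d f) (a : ι) (x : ι → Bool) :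
    |discDeriv a f x| ≤ d := by
  have h1 := h.1 _ _ (update_false_le_update_true a x)
  have h2 := h.2 _ _ (update_false_le_update_true a x)
  simp only [Pi.smul_apply, smul_eq_mul, ← mul_sub, total_update_sub, mul_one, Pi.neg_apply]
    at h1 h2
  unfold discDeriv
  exact abs_le.2 ⟨by linarith, by linarith⟩

lemma LipC.op (hq : Rates q) {l : List (ι → ℝ)} (hl : ∀ c ∈ l, Admissible c) {d D : ℝ}
    (hd : 0 ≤ d) {f : (ι → Bool) → ℝ} (h : LipC d f) (hD : IncLe (op q l total) (D • total)) :
    LipC (d * D) (op q l f) := by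
  have h1 := h.1.op hq hl
  have h2 := h.2.op hq hl
  rw [map_smul] at h1 h2
  rw [map_neg] at h2
  have h3 := hD.smul hd
  rw [smul_smul] at h3
  exact ⟨h1.trans h3, h2.trans h3⟩

/-- Control of a list of steps: Lipschitz constants are multiplied by at most `D`, and
`f - op q l f` is a sum of terms `g a - heat (q a) a (g a)` with discrete derivatives at most
`A` times the Lipschitz constant of `f`. -/
structure Ctl (q : ι → (ι → Bool) → ℝ) (l : List (ι → ℝ)) (D A : ℝ) : Prop where
  adm : ∀ c ∈ l, Admissible c
  inc : IncLe (op q l total) (D • total)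
  poisson : ∀ d f, 0 ≤ d → LipC d f → ∃ g : ι → (ι → Bool) → ℝ,
    (∀ x, f x - op q l f x = ∑ a, (g a x - heat (q a) a (g a) x)) ∧
      ∀ a x, |discDeriv a (g a) x| ≤ A * d

lemma discDeriv_add (a : ι) (F F' : (ι → Bool) → ℝ) (x : ι → Bool) :
    discDeriv a (F + F') x = discDeriv a F x + discDeriv a F' x := by
  simp [discDeriv]; ring

lemma discDeriv_smul (a : ι) (k : ℝ) (F : (ι → Bool) → ℝ) (x : ι → Bool) :
    discDeriv a (k • F) x = k * discDeriv a F x := by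
  simp [discDeriv]; ring

lemma Ctl.append (hq : Rates q) {l l' : List (ι → ℝ)} {D A D' A' : ℝ} (h : Ctl q l D A)
    (h' : Ctl q l' D' A') (hD' : 0 ≤ D') : Ctl q (l ++ l') (D' * D) (A' + D' * A) where
  adm c hc := (List.mem_append.1 hc).elim (h.adm c) (h'.adm c)
  inc := by
    intro x y hxy
    have h1 := h'.inc.op hq h.adm x y hxy
    have h2 := h.inc.smul hD' x y hxy
    rw [← op_append, map_smul] at h1
    rw [smul_smul] at h2
    exact h1.trans h2
  poisson d f hd hf := by
    obtain ⟨g', hg', hgb'⟩ := h'.poisson d f hd hf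
    obtain ⟨g, hg, hgb⟩ := h.poisson (d * D') _ (mul_nonneg hd hD') (hf.op hq h'.adm hd h'.inc)
    refine ⟨fun a => g' a + g a, fun x => ?_, fun a x => ?_⟩
    · have e1 := hg' x
      have e2 := hg x
      rw [op_append]
      simp only [map_add, Pi.add_apply]
      calc _ = (f x - op q l' f x) + (op q l' f x - op q l (op q l' f) x) := by ring
        _ = _ := by
          rw [e1, e2, ← sum_add_distrib]
          exact sum_congr rfl fun a _ => by ring
    · rw [discDeriv_add]
      refine (abs_add_le _ _).trans ((add_le_add (hgb' a x) (hgb a x)).trans (le_of_eq ?_))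
      ring

lemma ctl_of_load_le (hq : Rates q) {J : ι → ι → ℝ} {K : ℝ} (hJ : Influence q J K) {η : ℝ}
    (hηK : η * K ≤ 1 / 2) {l : List (ι → ℝ)} (hl : ∀ c ∈ l, Admissible c)
    (hload : ∀ a, load l a ≤ η) : Ctl q l 2 (2 * η) := by
  have hinc : ∀ l : List (ι → ℝ), (∀ c ∈ l, Admissible c) → (∀ a, load l a ≤ η) →
      IncLe (op q l total) ((2 : ℝ) • total) := by
    intro l hl hload
    obtain ⟨h1, h2⟩ := op_total_incLe_lin hq hJ hηK hl hload
    refine h1.trans fun x y hxy => ?_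
    simp only [lin, Pi.smul_apply, smul_eq_mul, total_apply, ← sum_sub_distrib, ← mul_sub]
    rw [Finset.mul_sum (f := fun e => coord e y - coord e x)]
    exact sum_le_sum fun e _ => mul_le_mul_of_nonneg_right (h2 e) (sub_nonneg.2 (coord_mono e hxy))
  refine ⟨hl, hinc l hl hload, fun d f hd hf => ?_⟩
  suffices H : ∃ g : ι → (ι → Bool) → ℝ,
      (∀ x, f x - op q l f x = ∑ a, (g a x - heat (q a) a (g a) x)) ∧
        ∀ a x, |discDeriv a (g a) x| ≤ 2 * load l a * d by
    obtain ⟨g, hg, hgb⟩ := H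
    refine ⟨g, hg, fun a x => (hgb a x).trans ?_⟩
    exact mul_le_mul_of_nonneg_right (mul_le_mul_of_nonneg_left (hload a) (by norm_num)) hd
  induction l with
  | nil => exact ⟨fun _ _ => 0, by simp [op_nil, heat_apply], by simp [discDeriv, load]⟩
  | cons c l ih =>
    have hl' : ∀ c ∈ l, Admissible c := fun c hc => hl c (by simp [hc])
    have hc := hl c (by simp)
    have hload' : ∀ a, load l a ≤ η := fun a => by
      have := hload a
      rw [load_cons] at this
      have := hc.nonneg a
      linarith
    obtain ⟨g, hg, hgb⟩ := ih hl' hload'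
    have hF := hf.op hq hl' hd (hinc l hl' hload')
    refine ⟨fun a => g a + c a • op q l f, fun x => ?_, fun a x => ?_⟩
    · have e1 := hg x
      rw [op_cons, step_apply]
      simp only [map_add, map_smul, Pi.add_apply, Pi.smul_apply, smul_eq_mul]
      calc _ = (f x - op q l f x) -
            ∑ a, c a * (heat (q a) a (op q l f) x - op q l f x) := by ring
        _ = _ := by
          rw [e1, ← sum_sub_distrib]
          exact sum_congr rfl fun a _ => by ring
    · rw [discDeriv_add, discDeriv_smul, load_cons]
      refine (abs_add_le _ _).trans ?_
      rw [abs_mul, abs_of_nonneg (hc.nonneg a)]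
      have := mul_le_mul_of_nonneg_left (hF.abs_discDeriv_le a x) (hc.nonneg a)
      linarith [hgb a x]

lemma Ctl.iterate (hq : Rates q) {l : List (ι → ℝ)} {A : ℝ} (hA : 0 ≤ A)
    (h : Ctl q l (1 / 2) A) (k : ℕ) :
    ∃ l', Ctl q l' ((1 / 2) ^ k) (2 * A) := by
  induction k with
  | zero =>
    refine ⟨[], by simp, fun x y _ => by simp [op_nil], fun d f hd _ => ?_⟩
    refine ⟨fun _ _ => 0, by simp [op_nil, heat_apply], fun a x => ?_⟩
    simp only [discDeriv, sub_self, abs_zero]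
    positivity
  | succ k ih =>
    obtain ⟨l', hl'⟩ := ih
    have := hl'.append hq h (by norm_num)
    refine ⟨l' ++ l, ?_⟩
    convert this using 1 <;> ring

lemma total_nonneg (x : ι → Bool) : 0 ≤ total x := by
  rw [total_apply]; exact sum_nonneg fun e _ => coord_nonneg e x

lemma total_le (x : ι → Bool) : total x ≤ Fintype.card ι := by
  rw [total_apply]
  refine (sum_le_sum fun e _ => coord_le_one e x).trans (le_of_eq ?_)
  simp

lemma LipC.abs_sub_mean_le {d : ℝ} (hd : 0 ≤ d) {f : (ι → Bool) → ℝ} (h : LipC d f)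
    {w : (ι → Bool) → ℝ} (hw0 : ∀ x, 0 ≤ w x) (hw1 : ∑ x, w x = 1) (x : ι → Bool) :
    |f x - mean w f| ≤ 2 * d * Fintype.card ι := by
  have hbot : ∀ y, |f y - f ⊥| ≤ d * Fintype.card ι := by
    intro y
    have h1 := h.1 ⊥ y bot_le
    have h2 := h.2 ⊥ y bot_le
    have h3 : d * total y ≤ d * Fintype.card ι := mul_le_mul_of_nonneg_left (total_le y) hd
    have h4 : 0 ≤ d * total (⊥ : ι → Bool) := mul_nonneg hd (total_nonneg _)
    simp only [Pi.smul_apply, smul_eq_mul, Pi.neg_apply] at h1 h2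
    exact abs_le.2 ⟨by linarith, by linarith⟩
  have hmean : f x - mean w f = ∑ y, w y * (f x - f y) := by
    simp only [mul_sub, sum_sub_distrib, ← sum_mul, hw1, one_mul, mean_apply]
  rw [hmean]
  calc |∑ y, w y * (f x - f y)| ≤ ∑ y, w y * (2 * d * Fintype.card ι) := by
        refine (abs_sum_le_sum_abs _ _).trans (sum_le_sum fun y _ => ?_)
        rw [abs_mul, abs_of_nonneg (hw0 y)]
        refine mul_le_mul_of_nonneg_left ?_ (hw0 y)
        have hx := abs_le.1 (hbot x)
        have hy := abs_le.1 (hbot y)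
        exact abs_le.2 ⟨by linarith, by linarith⟩
    _ = _ := by rw [← sum_mul, hw1, one_mul]

/-- Gaussian concentration from a list of steps that contracts Lipschitz constants. -/
lemma Ctl.tail_le (hq : Rates q) {l : List (ι → ℝ)} {A : ℝ} (hA : 0 ≤ A)
    (h : Ctl q l (1 / 2) A) {w : (ι → Bool) → ℝ} (hw0 : ∀ x, 0 ≤ w x) (hw1 : ∑ x, w x = 1)
    (hw : ∀ a, Balanced w (q a) a) {f : (ι → Bool) → ℝ} {v : ι → ℝ} {d : ℝ} (hd : 0 ≤ d)
    (hf : ∀ a x, |discDeriv a f x| ≤ v a) (hfd : LipC d f) {B : ℝ} (hB0 : 0 < B)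
    (hB : (∑ a, v a) * (2 * A * d) ≤ B) {t : ℝ} (ht : 0 ≤ t) :
    mean w (ind fun x => t < f x - mean w f) ≤ Real.exp (-(t ^ 2 / (2 * B))) := by
  refine ERGM.tail_le (q := q) (v := v) (L := fun _ => 2 * A * d) hw0 hw1 hw hq.blind hq.nonneg
    hq.le_one hf (fun ε hε => ?_) hB0 (by rwa [← sum_mul]) ht
  have hC : 0 ≤ 2 * d * (Fintype.card ι : ℝ) := by positivity
  obtain ⟨k, hk⟩ := exists_pow_lt_of_lt_one
    (div_pos hε (by linarith : 0 < 2 * d * (Fintype.card ι : ℝ) + 1))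
    (by norm_num : (1 / 2 : ℝ) < 1)
  obtain ⟨l', hl'⟩ := h.iterate hq hA k
  obtain ⟨g, hg, hgb⟩ := hl'.poisson d f hd hfd
  refine ⟨g, fun x => ?_, hgb⟩
  have h1 := (hfd.op hq hl'.adm hd hl'.inc).abs_sub_mean_le (by positivity) hw0 hw1 x
  rw [mean_op hq hw] at h1
  rw [← hg x]
  have h2 : f x - mean w f - (f x - op q l' f x) = op q l' f x - mean w f := by ring
  rw [h2]
  refine h1.trans ?_
  rw [lt_div_iff₀ (by linarith)] at hk
  have : 0 ≤ (1 / 2 : ℝ) ^ k := by positivity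
  nlinarith

end Dynamics

section Domination

variable {ι : Type*} [DecidableEq ι] [Fintype ι] {q : ι → (ι → Bool) → ℝ}

/-- `F` takes values in the unit interval and `σ • F` is monotone. -/
structure MonoUnit (σ : ℝ) (F : (ι → Bool) → ℝ) : Prop where
  nonneg : ∀ x, 0 ≤ F x
  le_one : ∀ x, F x ≤ 1
  mono : ∀ x y, x ≤ y → σ * F x ≤ σ * F y

lemma MonoUnit.op (hq : Rates q) {l : List (ι → ℝ)} (hl : ∀ c ∈ l, Admissible c) {σ : ℝ}
    {F : (ι → Bool) → ℝ} (h : MonoUnit σ F) : MonoUnit σ (op q l F) where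
  nonneg x := by
    have := op_le hq hl (F := fun _ => 0) h.nonneg x
    rwa [op_const] at this
  le_one x := by
    have := op_le hq hl (F' := fun _ => 1) h.le_one x
    rwa [op_const] at this
  mono x y hxy := by
    have := op_rel hq hl (F := (-σ) • F) (F' := (-σ) • F) (fun x y hxy => by
      have := h.mono x y hxy
      simp only [Pi.smul_apply, smul_eq_mul]
      linarith) hxy
    simp only [map_smul, Pi.smul_apply, smul_eq_mul] at this
    linarith

lemma mean_ind_nonneg {w : (ι → Bool) → ℝ} (hw : ∀ x, 0 ≤ w x) (A : (ι → Bool) → Prop) :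
    0 ≤ mean w (ind A) := sum_nonneg fun x _ => mul_nonneg (hw x) (ind_nonneg A x)

lemma mean_bern_heat_le {σ : ℝ} (hσ : σ = 1 ∨ σ = -1) {r : ι → ℝ} (h0 : ∀ a, 0 ≤ r a)
    (h1 : ∀ a, r a ≤ 1) {F : (ι → Bool) → ℝ} (hF : MonoUnit σ F) (hq : Rates q) {a : ι} {s κ : ℝ}
    (hs0 : 0 ≤ s) (hs1 : s ≤ 1)
    (hκ : mean (bern r) (ind fun x => 0 < σ * (q a x - s)) ≤ κ) :
    mean (bern r) (heat (q a) a F) ≤ mean (bern (Function.update r a s)) F + κ := by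
  rw [← mean_bern_heat]
  refine le_trans ?_ (add_le_add_right hκ _)
  rw [← map_add]
  refine mean_mono (bern_nonneg h0 h1) fun x => ?_
  rw [Pi.add_apply, heat_apply, heat_apply]
  have hm := hF.mono _ _ (update_false_le_update_true a x)
  have a0 := hF.nonneg (Function.update x a false)
  have a1 := hF.le_one (Function.update x a false)
  have b0 := hF.nonneg (Function.update x a true)
  have b1 := hF.le_one (Function.update x a true)
  have q0 := hq.nonneg a x
  have q1 := hq.le_one a x
  by_cases hA : 0 < σ * (q a x - s)
  · have : ind (fun x => 0 < σ * (q a x - s)) x = 1 := by simp [ind, hA]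
    rw [this]
    rcases hσ with rfl | rfl <;> nlinarith
  · have : ind (fun x => 0 < σ * (q a x - s)) x = 0 := by simp [ind, hA]
    rw [this]
    rcases hσ with rfl | rfl <;> nlinarith

lemma mean_bern_update_affine (r : ι → ℝ) (a : ι) (η s : ℝ) (F : (ι → Bool) → ℝ) :
    mean (bern (Function.update r a ((1 - η) * r a + η * s))) F =
      (1 - η) * mean (bern r) F + η * mean (bern (Function.update r a s)) F := by
  have h := mean_bern_heat r a (r a) F
  rw [Function.update_eq_self] at h
  have hmix : heat (fun _ => (1 - η) * r a + η * s) a F =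
      (1 - η) • heat (fun _ => r a) a F + η • heat (fun _ => s) a F := by
    ext x
    simp only [heat_apply, Pi.add_apply, Pi.smul_apply, smul_eq_mul]
    ring
  rw [← mean_bern_heat, ← mean_bern_heat, hmix, map_add, map_smul, map_smul, h]
  rfl

lemma admissible_single (a : ι) {η : ℝ} (h0 : 0 ≤ η) (h1 : η ≤ 1) :
    Admissible (Pi.single a η : ι → ℝ) where
  nonneg e := by
    by_cases h : e = a
    · subst h; simpa
    · simp [h]
  sum_le := by simpa [Finset.sum_pi_single'] using h1

lemma step_single (a : ι) (η : ℝ) (F : (ι → Bool) → ℝ) :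
    step q (Pi.single a η) F = (1 - η) • F + η • heat (q a) a F := by
  ext x
  rw [step_apply, Finset.sum_eq_single a (fun b _ hb => by simp [hb]) (by simp)]
  simp
  ring

lemma mean_bern_step_single_le {σ : ℝ} (hσ : σ = 1 ∨ σ = -1) {r : ι → ℝ} (h0 : ∀ a, 0 ≤ r a)
    (h1 : ∀ a, r a ≤ 1) {F : (ι → Bool) → ℝ} (hF : MonoUnit σ F) (hq : Rates q) {a : ι}
    {s κ η : ℝ} (hs0 : 0 ≤ s) (hs1 : s ≤ 1) (hη0 : 0 ≤ η) (hη1 : η ≤ 1)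
    (hκ : mean (bern r) (ind fun x => 0 < σ * (q a x - s)) ≤ κ) :
    mean (bern r) (step q (Pi.single a η) F) ≤
      mean (bern (Function.update r a ((1 - η) * r a + η * s))) F + κ := by
  have hκ0 : 0 ≤ κ := (mean_ind_nonneg (bern_nonneg h0 h1) _).trans hκ
  rw [step_single, mean_bern_update_affine, map_add, map_smul, map_smul, smul_eq_mul, smul_eq_mul]
  have := mul_le_mul_of_nonneg_left (mean_bern_heat_le hσ h0 h1 hF hq hs0 hs1 hκ) hη0
  nlinarith

lemma mean_bern_step_le {σ : ℝ} (hσ : σ = 1 ∨ σ = -1) {r : ι → ℝ} (h0 : ∀ a, 0 ≤ r a)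
    (h1 : ∀ a, r a ≤ 1) {F : (ι → Bool) → ℝ} (hF : MonoUnit σ F) (hq : Rates q) {κ : ℝ}
    (hκ0 : 0 ≤ κ) (hκ : ∀ a, mean (bern r) (ind fun x => 0 < σ * (q a x - r a)) ≤ κ)
    {c : ι → ℝ} (hc : Admissible c) :
    mean (bern r) (step q c F) ≤ mean (bern r) F + κ := by
  have : step q c F = F + ∑ a, c a • (heat (q a) a F - F) := by
    simp [step, LinearMap.sum_apply]
  rw [this, map_add, map_sum]
  gcongr
  calc ∑ a, mean (bern r) (c a • (heat (q a) a F - F)) ≤ ∑ a, c a * κ := by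
        refine sum_le_sum fun a _ => ?_
        rw [map_smul, smul_eq_mul, map_sub]
        refine mul_le_mul_of_nonneg_left ?_ (hc.nonneg a)
        have := mean_bern_heat_le hσ h0 h1 hF hq (h0 a) (h1 a) (hκ a)
        rw [Function.update_eq_self] at this
        linarith
    _ ≤ κ := by
        rw [← sum_mul]
        exact mul_le_of_le_one_left hκ0 hc.sum_le

/-- The lazy systematic scan of a list of coordinates. -/
def scan (η : ℝ) (as : List ι) : List (ι → ℝ) := as.map fun a => Pi.single a η

lemma mean_bern_scan_le {σ : ℝ} (hσ : σ = 1 ∨ σ = -1) {F : (ι → Bool) → ℝ} (hF : MonoUnit σ F)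
    (hq : Rates q) {ρ s κ η : ℝ} (hs0 : 0 ≤ s) (hs1 : s ≤ 1) (hη0 : 0 ≤ η) (hη1 : η ≤ 1)
    (hρ0 : 0 ≤ ρ) (hρ1 : ρ ≤ 1) (hsρ : σ * s ≤ σ * ρ)
    (hκ : ∀ r : ι → ℝ, (∀ a, 0 ≤ r a) → (∀ a, r a ≤ 1) → (∀ a, σ * r a ≤ σ * ρ) →
      ∀ a, mean (bern r) (ind fun x => 0 < σ * (q a x - s)) ≤ κ)
    (as : List ι) (has : as.Nodup) (r : ι → ℝ) (h0 : ∀ a, 0 ≤ r a) (h1 : ∀ a, r a ≤ 1)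
    (hr : ∀ a, σ * r a ≤ σ * ρ) (hras : ∀ a ∈ as, r a = ρ) :
    mean (bern r) (op q (scan η as) F) ≤
      mean (bern fun a => if a ∈ as then (1 - η) * ρ + η * s else r a) F + as.length * κ := by
  induction as generalizing r with
  | nil => simp [scan, op_nil]
  | cons a as ih =>
    have ha : r a = ρ := hras a (by simp)
    obtain ⟨hna, hnd⟩ := List.nodup_cons.1 has
    set r' := Function.update r a ((1 - η) * r a + η * s) with hr'
    have hadm : ∀ c ∈ scan η as, Admissible c := by
      intro c hc
      obtain ⟨b, _, rfl⟩ := List.mem_map.1 hc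
      exact admissible_single b hη0 hη1
    have hall : ∀ e, 0 ≤ r' e ∧ r' e ≤ 1 ∧ σ * r' e ≤ σ * ρ := by
      intro e
      by_cases he : e = a
      · subst he
        simp only [hr', Function.update_self, ha]
        refine ⟨by nlinarith, by nlinarith, by nlinarith⟩
      · simp only [hr', Function.update_of_ne he]
        exact ⟨h0 e, h1 e, hr e⟩
    have e1 := mean_bern_step_single_le hσ h0 h1 (hF.op hq hadm) hq hs0 hs1 hη0 hη1
      (hκ r h0 h1 hr a)
    have e2 := ih hnd r' (fun e => (hall e).1) (fun e => (hall e).2.1) (fun e => (hall e).2.2)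
      (fun e he => by
        have : e ≠ a := fun h => hna (h ▸ he)
        simp only [hr', Function.update_of_ne this]
        exact hras e (by simp [he]))
    have e3 : (fun e => if e ∈ as then (1 - η) * ρ + η * s else r' e) =
        fun e => if e ∈ a :: as then (1 - η) * ρ + η * s else r e := by
      ext e
      by_cases he : e = a
      · subst he
        simp [hr', ha, hna]
      · simp [hr', he]
    rw [e3] at e2
    have : scan η (a :: as) = Pi.single a η :: scan η as := rfl
    rw [this, op_cons]
    push_cast [List.length_cons]
    linarith

/-- The lazy systematic scan of all coordinates. -/
noncomputable def sweep (ι : Type*) [DecidableEq ι] [Fintype ι] (η : ℝ) : List (ι → ℝ) :=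
  scan η (univ : Finset ι).toList

/-- `T` systematic scans. -/
noncomputable def sweeps (ι : Type*) [DecidableEq ι] [Fintype ι] (η : ℝ) :
    ℕ → List (ι → ℝ)
  | 0 => []
  | T + 1 => sweep ι η ++ sweeps ι η T

lemma admissible_of_mem_sweep {η : ℝ} (hη0 : 0 ≤ η) (hη1 : η ≤ 1) :
    ∀ c ∈ sweep ι η, Admissible c := by
  intro c hc
  obtain ⟨b, _, rfl⟩ := List.mem_map.1 hc
  exact admissible_single b hη0 hη1

lemma admissible_of_mem_sweeps {η : ℝ} (hη0 : 0 ≤ η) (hη1 : η ≤ 1) (T : ℕ) :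
    ∀ c ∈ sweeps ι η T, Admissible c := by
  induction T with
  | zero => simp [sweeps]
  | succ T ih =>
    intro c hc
    exact (List.mem_append.1 hc).elim (admissible_of_mem_sweep hη0 hη1 c) (ih c)

/-- Under every product measure whose parameters are dominated by `ρ` (in the direction `σ`), the
rates are smaller than `ρ` by at least `γ`, up to probability `κ`. -/
structure Drift (q : ι → (ι → Bool) → ℝ) (σ ρ γ κ : ℝ) : Prop where
  nonneg : 0 ≤ ρ
  le_one : ρ ≤ 1
  sub_nonneg : 0 ≤ ρ - σ * γ
  sub_le_one : ρ - σ * γ ≤ 1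
  tail : ∀ r : ι → ℝ, (∀ a, 0 ≤ r a) → (∀ a, r a ≤ 1) → (∀ a, σ * r a ≤ σ * ρ) →
    ∀ a, mean (bern r) (ind fun x => σ * (ρ - q a x) < γ) ≤ κ

lemma Drift.mean_sweep_le {σ : ℝ} (hσ : σ = 1 ∨ σ = -1) {F : (ι → Bool) → ℝ}
    (hF : MonoUnit σ F) (hq : Rates q) {ρ γ κ η d : ℝ} (h : Drift q σ ρ γ κ) (hη0 : 0 < η)
    (hη1 : η ≤ 1) (hd0 : 0 ≤ d) (hd : d ≤ η * γ) :
    mean (bern fun _ => ρ) (op q (sweep ι η) F) ≤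
      mean (bern fun _ => ρ - σ * d) F + Fintype.card ι * κ := by
  have hdη : d / η ≤ γ := by rw [div_le_iff₀ hη0]; linarith
  have hdη0 : 0 ≤ d / η := by positivity
  have n0 := h.nonneg
  have n1 := h.le_one
  have n2 := h.sub_nonneg
  have n3 := h.sub_le_one
  have hσ2 : σ * σ = 1 := by rcases hσ with rfl | rfl <;> norm_num
  have hs : 0 ≤ ρ - σ * (d / η) ∧ ρ - σ * (d / η) ≤ 1 := by
    rcases hσ with rfl | rfl <;> constructor <;> linarith
  have hsρ : σ * (ρ - σ * (d / η)) = σ * ρ - d / η := by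
    rw [mul_sub, ← mul_assoc, hσ2, one_mul]
  have key := mean_bern_scan_le hσ hF hq hs.1 hs.2 hη0.le hη1 h.nonneg h.le_one
    (by rw [hsρ]; linarith) (κ := κ) (fun r h0 h1 hr a => by
      refine le_trans (mean_mono (bern_nonneg h0 h1) fun x => ind_mono fun hx => ?_)
        (h.tail r h0 h1 hr a)
      rw [mul_sub, hsρ] at hx
      linarith) (univ : Finset ι).toList (Finset.nodup_toList _) (fun _ => ρ)
      (fun _ => h.nonneg) (fun _ => h.le_one) (fun _ => le_rfl) (fun _ _ => rfl)
  have he : (1 - η) * ρ + η * (ρ - σ * (d / η)) = ρ - σ * d := by field_simp; ring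
  simpa [he, sweep] using key

lemma mean_sweeps_le {σ : ℝ} (hσ : σ = 1 ∨ σ = -1) {F : (ι → Bool) → ℝ}
    (hF : MonoUnit σ F) (hq : Rates q) {γ κ η d : ℝ} (hη0 : 0 < η)
    (hη1 : η ≤ 1) (hd0 : 0 ≤ d) (hd : d ≤ η * γ) (T : ℕ) (ρ : ℝ)
    (h : ∀ k : ℕ, k < T → Drift q σ (ρ - σ * (d * k)) γ κ) :
    mean (bern fun _ => ρ) (op q (sweeps ι η T) F) ≤
      mean (bern fun _ => ρ - σ * (d * T)) F + T * (Fintype.card ι * κ) := by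
  induction T generalizing ρ with
  | zero => simp [sweeps, op_nil]
  | succ T ih =>
    rw [sweeps, op_append]
    have h0 := h 0 (by omega)
    simp only [Nat.cast_zero, mul_zero, sub_zero] at h0
    have e1 := h0.mean_sweep_le hσ (hF.op hq (admissible_of_mem_sweeps hη0.le hη1 T)) hq hη0 hη1
      hd0 hd
    have e2 := ih (ρ - σ * d) fun k hk => by
      have := h (k + 1) (by omega)
      convert this using 1
      push_cast
      ring
    have e3 : ρ - σ * d - σ * (d * T) = ρ - σ * (d * ((T + 1 : ℕ) : ℝ)) := by push_cast; ring
    rw [e3] at e2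
    refine e1.trans ((add_le_add_left e2 _).trans (le_of_eq ?_))
    push_cast
    ring

lemma Drift.mean_replicate_le {σ : ℝ} (hσ : σ = 1 ∨ σ = -1) {F : (ι → Bool) → ℝ}
    (hF : MonoUnit σ F) (hq : Rates q) {ρ γ κ : ℝ} (h : Drift q σ ρ γ κ) (hγ : 0 < γ)
    (hκ : 0 ≤ κ) {c : ι → ℝ} (hc : Admissible c) (j : ℕ) :
    mean (bern fun _ => ρ) (op q (List.replicate j c) F) ≤
      mean (bern fun _ => ρ) F + j * κ := by
  induction j with
  | zero => simp [op_nil]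
  | succ j ih =>
    rw [List.replicate_succ, op_cons]
    have hF' := hF.op hq (l := List.replicate j c) fun c' hc' => by
      rw [List.eq_of_mem_replicate hc']; exact hc
    have e1 := mean_bern_step_le hσ (fun _ => h.nonneg) (fun _ => h.le_one) hF' hq hκ
      (fun a => le_trans (mean_mono (bern_nonneg (fun _ => h.nonneg) (fun _ => h.le_one))
        fun x => ind_mono fun hx => by linarith)
        (h.tail (fun _ => ρ) (fun _ => h.nonneg) (fun _ => h.le_one) (fun _ => le_rfl) a)) hc
    push_cast
    linarith

lemma mean_bern_extreme (b : Bool) (F : (ι → Bool) → ℝ) :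
    mean (bern fun _ => if b = true then 1 else 0) F = F fun _ => b := by
  rw [mean_apply, Finset.sum_eq_single fun _ => b]
  · cases b <;> simp [bern]
  · intro x _ hx
    obtain ⟨e, he⟩ := Function.ne_iff.1 hx
    refine mul_eq_zero_of_left (prod_eq_zero (mem_univ e) ?_) _
    cases b <;> cases hxe : x e <;> simp_all
  · simp

/-- Expectation bound along the dynamics started from an extreme configuration. -/
lemma op_extreme_le {σ : ℝ} {b : Bool} (hσ : σ = 1 ∧ b = true ∨ σ = -1 ∧ b = false)
    {F : (ι → Bool) → ℝ} (hF : MonoUnit σ F) (hq : Rates q) {ρ γ κ η : ℝ} (hη0 : 0 < η)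
    (hη1 : η ≤ 1) (hγ : 0 < γ) (hκ : 0 ≤ κ) {T : ℕ} (hT : 1 ≤ T * (η * γ))
    (hρ0 : 0 ≤ ρ) (hρ1 : ρ ≤ 1)
    (h : ∀ ρ' : ℝ, 0 ≤ ρ' → ρ' ≤ 1 → σ * ρ ≤ σ * ρ' → Drift q σ ρ' γ κ) {c : ι → ℝ}
    (hc : Admissible c) (j : ℕ) :
    op q (sweeps ι η T ++ List.replicate j c) F (fun _ => b) ≤
      mean (bern fun _ => ρ) F + (T * Fintype.card ι + j) * κ := by
  have hσ' : σ = 1 ∨ σ = -1 := hσ.imp And.left And.left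
  have hTpos : (0 : ℝ) < T := by
    rcases Nat.eq_zero_or_pos T with rfl | hT0
    · norm_num at hT
    · exact_mod_cast hT0
  set start : ℝ := if b = true then 1 else 0 with hstart
  set d : ℝ := σ * (start - ρ) / T with hd
  have hdT : d * T = σ * (start - ρ) := by rw [hd]; field_simp
  have hσ2 : σ * σ = 1 := by rcases hσ' with rfl | rfl <;> norm_num
  have hdiff : 0 ≤ σ * (start - ρ) ∧ σ * (start - ρ) ≤ 1 := by
    rcases hσ with ⟨rfl, rfl⟩ | ⟨rfl, rfl⟩ <;> simp [hstart] <;> constructor <;> linarith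
  have hd0 : 0 ≤ d := div_nonneg hdiff.1 hTpos.le
  have hdη : d ≤ η * γ := by
    rw [hd, div_le_iff₀ hTpos]
    linarith [hdiff.2]
  have hend : start - σ * (d * T) = ρ := by
    rw [hdT, ← mul_assoc, hσ2]; ring
  rw [← mean_bern_extreme b (op q _ F), ← hstart, op_append]
  have hadm : ∀ c' ∈ List.replicate j c, Admissible c' := fun c' hc' => by
    rw [List.eq_of_mem_replicate hc']; exact hc
  have e1 := mean_sweeps_le hσ' (hF.op hq hadm) hq hη0 hη1 hd0 hdη T start fun k hk => by
    have hk' : d * k ≤ d * T := mul_le_mul_of_nonneg_left (by exact_mod_cast hk.le) hd0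
    have hk0 : 0 ≤ d * k := by positivity
    have hs : start = 0 ∨ start = 1 := by simp only [hstart]; split_ifs <;> simp
    rw [hdT] at hk'
    rcases hσ with ⟨rfl, rfl⟩ | ⟨rfl, rfl⟩ <;> simp only [hstart] at hk' ⊢ <;> norm_num at hk' ⊢ <;>
      apply h <;> linarith
  rw [hend] at e1
  have e2 := (h ρ hρ0 hρ1 le_rfl).mean_replicate_le hσ' hF hq hγ hκ hc j
  refine e1.trans ((add_le_add_left e2 _).trans (le_of_eq ?_))
  ring

end Domination

section Contraction

variable {ι : Type*} [DecidableEq ι] [Fintype ι] {q : ι → (ι → Bool) → ℝ}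

lemma Ctl.flatten (hq : Rates q) {A : ℝ} {L : List (List (ι → ℝ))} (h : ∀ l ∈ L, Ctl q l 2 A) :
    Ctl q L.flatten (2 ^ L.length) ((2 ^ L.length - 1) * A) := by
  induction L with
  | nil =>
    refine ⟨by simp, fun x y _ => by simp [op_nil], fun d f hd _ => ?_⟩
    exact ⟨fun _ _ => 0, by simp [op_nil, heat_apply], fun a x => by simp [discDeriv]⟩
  | cons l L ih =>
    have := (h l (by simp)).append hq (ih fun l' hl' => h l' (by simp [hl'])) (by positivity)
    rw [List.flatten_cons]
    convert this using 1
    · simp [pow_succ]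
    · simp [pow_succ]; ring

lemma sweeps_eq_flatten (η : ℝ) (T : ℕ) :
    sweeps ι η T = (List.replicate T (sweep ι η)).flatten := by
  induction T with
  | zero => rfl
  | succ T ih => rw [sweeps, ih, List.replicate_succ, List.flatten_cons]

lemma load_sweep (η : ℝ) (a : ι) : load (sweep ι η) a = η := by
  rw [load, sweep, scan, List.map_map]
  have : ((fun c : ι → ℝ => c a) ∘ fun b => (Pi.single b η : ι → ℝ)) =
      fun b => (Pi.single b η : ι → ℝ) a := rfl
  rw [this, Finset.sum_map_toList, Finset.sum_eq_single a (fun b _ hb => by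
    simp [hb.symm]) (by simp)]
  simp

/-- The weights of the uniform random scan. -/
noncomputable def uniformScan (ι : Type*) [Fintype ι] (η : ℝ) : ι → ℝ :=
  fun _ => η / Fintype.card ι

lemma admissible_uniformScan {η : ℝ} (h0 : 0 ≤ η) (h1 : η ≤ 1) :
    Admissible (uniformScan ι η) where
  nonneg _ := by unfold uniformScan; positivity
  sum_le := by
    rcases Nat.eq_zero_or_pos (Fintype.card ι) with h | h
    · simp [uniformScan, h]
    · have : (0 : ℝ) < Fintype.card ι := by exact_mod_cast h
      simp only [uniformScan, sum_const, card_univ, nsmul_eq_mul]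
      rwa [mul_div_cancel₀ _ this.ne']

/-- `T₁` systematic scans, followed by `T₂` time units of random scan. -/
noncomputable def epoch (ι : Type*) [DecidableEq ι] [Fintype ι] (η : ℝ) (T₁ T₂ : ℕ) :
    List (ι → ℝ) :=
  sweeps ι η T₁ ++ List.replicate (T₂ * Fintype.card ι) (uniformScan ι η)

lemma ctl_epoch (hq : Rates q) {J : ι → ι → ℝ} {K : ℝ} (hJ : Influence q J K) {η : ℝ}
    (hηK : η * K ≤ 1 / 2) (hη0 : 0 ≤ η) (hη1 : η ≤ 1) (T₁ T₂ : ℕ) :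
    Ctl q (epoch ι η T₁ T₂) (2 ^ (T₁ + T₂)) ((2 ^ (T₁ + T₂) - 1) * (2 * η)) := by
  have h1 : Ctl q (sweep ι η) 2 (2 * η) :=
    ctl_of_load_le hq hJ hηK (admissible_of_mem_sweep hη0 hη1) fun a => (load_sweep η a).le
  have h2 : Ctl q (List.replicate (Fintype.card ι) (uniformScan ι η)) 2 (2 * η) := by
    refine ctl_of_load_le hq hJ hηK (fun c hc => ?_) fun a => ?_
    · rw [List.eq_of_mem_replicate hc]; exact admissible_uniformScan hη0 hη1
    · have : (0 : ℝ) < Fintype.card ι := by exact_mod_cast Fintype.card_pos_iff.2 ⟨a⟩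
      simp only [load, List.map_replicate, List.sum_replicate, nsmul_eq_mul, uniformScan]
      rw [mul_div_cancel₀ _ this.ne']
  have := Ctl.flatten hq (L := List.replicate T₁ (sweep ι η) ++
    List.replicate T₂ (List.replicate (Fintype.card ι) (uniformScan ι η))) fun l hl => by
      rcases List.mem_append.1 hl with h | h <;> rw [List.eq_of_mem_replicate h] <;> assumption
  rw [List.flatten_append, ← sweeps_eq_flatten, List.flatten_replicate_replicate] at this
  simpa [epoch] using this

lemma step_uniformScan_total (η : ℝ) (x : ι → Bool) :
    step q (uniformScan ι η) total x =
      total x + η / Fintype.card ι * (∑ a, q a x - total x) := by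
  rw [total, step_lin, ← total, total_apply, ← sum_sub_distrib, mul_sum]
  simp [uniformScan]

/-- If the total increment of the rates is contracted outside of the events described by `b₁` and
`b₀`, which are unlikely along the dynamics, then Lipschitz constants are contracted. -/
lemma op_total_increment_le (hq : Rates q) {η δ κ : ℝ} (hη0 : 0 ≤ η) (hη1 : η ≤ 1)
    (hδ0 : 0 ≤ δ) (hδ1 : δ ≤ 1) (hcard : 0 < Fintype.card ι) {b₀ b₁ : (ι → Bool) → ℝ}
    (hb₀ : ∀ x, 0 ≤ b₀ x) (hb₁ : ∀ x, 0 ≤ b₁ x)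
    (hcontr : ∀ x y, x ≤ y → ∑ a, q a y - ∑ a, q a x ≤
      (1 - δ) * (total y - total x) + Fintype.card ι * (b₁ y + b₀ x))
    {l : List (ι → ℝ)} (hl : ∀ c ∈ l, Admissible c) (m : ℕ)
    (hbad : ∀ j < m, ∀ x y, x ≤ y →
      op q (l ++ List.replicate j (uniformScan ι η)) b₁ y +
        op q (l ++ List.replicate j (uniformScan ι η)) b₀ x ≤ κ)
    {x y : ι → Bool} (hxy : x ≤ y) :
    op q (l ++ List.replicate m (uniformScan ι η)) total y -
        op q (l ++ List.replicate m (uniformScan ι η)) total x ≤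
      (1 - δ * η / Fintype.card ι) ^ m * (op q l total y - op q l total x) + m * κ := by
  have hM : (1 : ℝ) ≤ Fintype.card ι := by exact_mod_cast hcard
  have hM0 : (0 : ℝ) < Fintype.card ι := by linarith
  set k : ℝ := 1 - δ * η / Fintype.card ι with hk
  have hk1 : k ≤ 1 := by
    have : 0 ≤ δ * η / Fintype.card ι := by positivity
    linarith
  have hk0 : 0 ≤ k := by
    have : δ * η / Fintype.card ι ≤ 1 := by
      rw [div_le_one hM0]; nlinarith
    linarith
  have hrel : ∀ x y, x ≤ y →
      (step q (uniformScan ι η) total - k • total - b₁ : (ι → Bool) → ℝ) y ≤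
        (step q (uniformScan ι η) total - k • total + b₀ : (ι → Bool) → ℝ) x := by
    intro x y hxy
    have h := hcontr x y hxy
    simp only [Pi.sub_apply, Pi.add_apply, Pi.smul_apply, smul_eq_mul, step_uniformScan_total]
    have h1 := mul_le_mul_of_nonneg_left h (by positivity : 0 ≤ η / Fintype.card ι)
    have h2 : η / Fintype.card ι * (Fintype.card ι * (b₁ y + b₀ x)) = η * (b₁ y + b₀ x) := by
      field_simp
    rw [mul_add, h2] at h1
    have h3 : η * (b₁ y + b₀ x) ≤ b₁ y + b₀ x :=
      mul_le_of_le_one_left (add_nonneg (hb₁ y) (hb₀ x)) hη1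
    have h4 : k = 1 - δ * (η / Fintype.card ι) := by rw [hk]; ring
    rw [h4]
    linarith
  induction m with
  | zero => simp
  | succ m ih =>
    have hb := hbad m (by omega) x y hxy
    have ih' := ih fun j hj => hbad j (by omega)
    set l' := l ++ List.replicate m (uniformScan ι η) with hl'
    have hadm : ∀ c ∈ l', Admissible c := by
      intro c hc
      rcases List.mem_append.1 hc with h | h
      · exact hl c h
      · rw [List.eq_of_mem_replicate h]; exact admissible_uniformScan hη0 hη1
    have h := op_rel hq hadm hrel hxy
    simp only [map_sub, map_add, map_smul, Pi.sub_apply, Pi.add_apply, Pi.smul_apply,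
      smul_eq_mul] at h
    rw [List.replicate_succ', ← List.append_assoc, ← hl']
    simp only [op_append l', op_cons, op_nil]
    have h5 := mul_le_mul_of_nonneg_left ih' hk0
    have h6 : 0 ≤ op q l' b₁ y + op q l' b₀ x := by
      have e1 := op_le hq hadm (F := fun _ => 0) hb₁ y
      have e2 := op_le hq hadm (F := fun _ => 0) hb₀ x
      rw [op_const] at e1 e2
      exact add_nonneg e1 e2
    have h7 : k * (m * κ) ≤ m * κ := mul_le_of_le_one_left (by
      have : 0 ≤ κ := h6.trans hb
      positivity) hk1
    rw [pow_succ]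
    push_cast
    nlinarith

lemma one_le_total_sub {x y : ι → Bool} (hxy : x ≤ y) (hne : x ≠ y) : 1 ≤ total y - total x := by
  obtain ⟨e, he⟩ := Function.ne_iff.1 hne
  rw [total_apply, total_apply, ← sum_sub_distrib]
  refine le_trans ?_ (single_le_sum (f := fun e => coord e y - coord e x)
    (fun e _ => sub_nonneg.2 (coord_mono e hxy)) (mem_univ e))
  have h := hxy e
  unfold coord
  cases hx : x e <;> cases hy : y e <;> rw [hx, hy] at h he
  · exact absurd rfl he
  · norm_num
  · exact absurd (h rfl) (by simp)
  · exact absurd rfl he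

lemma pow_mul_card_le {δ η : ℝ} (hη0 : 0 ≤ η) (hη1 : η ≤ 1)
    (hδ1 : δ ≤ 1) {M : ℕ} (hM : 0 < M) (T : ℕ) :
    (1 - δ * η / M) ^ (T * M) ≤ Real.exp (-(δ * η * T)) := by
  have hM0 : (1 : ℝ) ≤ M := by exact_mod_cast hM
  have h1 : δ * η / M ≤ 1 := by
    rw [div_le_one (by linarith)]; nlinarith
  have h2 : 1 - δ * η / M ≤ Real.exp (-(δ * η / M)) := by
    have := Real.add_one_le_exp (-(δ * η / M)); linarith
  refine (pow_le_pow_left₀ (by linarith) h2 _).trans (le_of_eq ?_)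
  rw [← Real.exp_nat_mul]
  congr 1
  push_cast
  field_simp

/-- The epoch halves Lipschitz constants. -/
lemma ctl_epoch_half (hq : Rates q) {J : ι → ι → ℝ} {K : ℝ} (hJ : Influence q J K)
    {η δ κ γ : ℝ} (hηK : η * K ≤ 1 / 2) (hη0 : 0 < η) (hη1 : η ≤ 1)
    (hδ0 : 0 ≤ δ) (hδ1 : δ ≤ 1) (hcard : 0 < Fintype.card ι) (hγ : 0 < γ) (hκ : 0 ≤ κ)
    {b₀ b₁ : (ι → Bool) → ℝ} (hb₀ : MonoUnit (-1) b₀) (hb₁ : MonoUnit 1 b₁)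
    (hcontr : ∀ x y, x ≤ y → ∑ a, q a y - ∑ a, q a x ≤
      (1 - δ) * (total y - total x) + Fintype.card ι * (b₁ y + b₀ x))
    {ρ₀ ρ₁ : ℝ} (hρ₀ : 0 ≤ ρ₀) (hρ₀' : ρ₀ ≤ 1) (hρ₁ : 0 ≤ ρ₁) (hρ₁' : ρ₁ ≤ 1)
    (hd₀ : ∀ ρ, 0 ≤ ρ → ρ ≤ ρ₀ → Drift q (-1) ρ γ κ)
    (hd₁ : ∀ ρ, ρ₁ ≤ ρ → ρ ≤ 1 → Drift q 1 ρ γ κ)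
    (hm₀ : mean (bern fun _ => ρ₀) b₀ ≤ κ) (hm₁ : mean (bern fun _ => ρ₁) b₁ ≤ κ)
    {T₁ T₂ : ℕ} (hT₁ : 1 ≤ T₁ * (η * γ)) (hT₂ : 2 ^ T₁ * Real.exp (-(δ * η * T₂)) ≤ 1 / 4)
    (hsmall : T₂ * Fintype.card ι *
      (2 * (1 + T₁ * Fintype.card ι + T₂ * Fintype.card ι) * κ) ≤ 1 / 4) :
    Ctl q (epoch ι η T₁ T₂) (1 / 2) ((2 ^ (T₁ + T₂) - 1) * (2 * η)) := by
  have hctl := ctl_epoch hq hJ hηK hη0.le hη1 T₁ T₂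
  refine ⟨hctl.adm, fun x y hxy => ?_, hctl.poisson⟩
  simp only [Pi.smul_apply, smul_eq_mul, ← mul_sub]
  rcases eq_or_ne x y with rfl | hne
  · simp
  have hone := one_le_total_sub hxy hne
  set M : ℝ := (Fintype.card ι : ℝ) with hM
  have hM1 : 1 ≤ M := by rw [hM]; exact_mod_cast hcard
  have hsw := admissible_of_mem_sweeps (ι := ι) hη0.le hη1 T₁
  have hus := admissible_uniformScan (ι := ι) hη0.le hη1
  have hbad : ∀ j < T₂ * Fintype.card ι, ∀ x y, x ≤ y →
      op q (sweeps ι η T₁ ++ List.replicate j (uniformScan ι η)) b₁ y +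
        op q (sweeps ι η T₁ ++ List.replicate j (uniformScan ι η)) b₀ x ≤
      2 * (1 + T₁ * M + T₂ * M) * κ := by
    intro j hj x y _
    have hadm : ∀ c ∈ sweeps ι η T₁ ++ List.replicate j (uniformScan ι η), Admissible c := by
      intro c hc
      rcases List.mem_append.1 hc with h | h
      · exact hsw c h
      · rw [List.eq_of_mem_replicate h]; exact hus
    have e1 := (hb₁.op hq hadm).mono y (fun _ => true) (fun e => Bool.le_true _)
    have e2 := (hb₀.op hq hadm).mono (fun _ => false) x (fun e => Bool.false_le _)
    have e3 := op_extreme_le (σ := 1) (b := true) (Or.inl ⟨rfl, rfl⟩) hb₁ hq hη0 hη1 hγ hκ hT₁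
      hρ₁ hρ₁' (fun ρ _ h1 h => hd₁ ρ (by linarith) h1) hus j
    have e4 := op_extreme_le (σ := -1) (b := false) (Or.inr ⟨rfl, rfl⟩) hb₀ hq hη0 hη1 hγ hκ hT₁
      hρ₀ hρ₀' (fun ρ h0 _ h => hd₀ ρ h0 (by linarith)) hus j
    have hjM : (j : ℝ) ≤ T₂ * M := by rw [hM]; exact_mod_cast hj.le
    have : (j : ℝ) * κ ≤ T₂ * M * κ := mul_le_mul_of_nonneg_right hjM hκ
    rw [← hM] at e3 e4
    nlinarith
  have key := op_total_increment_le hq hη0.le hη1 hδ0 hδ1 hcard hb₀.nonneg hb₁.nonneg hcontr hsw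
    (T₂ * Fintype.card ι) hbad hxy
  have hk := pow_mul_card_le hη0.le hη1 hδ1 hcard T₂
  have hs : Ctl q (sweeps ι η T₁) (2 ^ T₁) ((2 ^ T₁ - 1) * (2 * η)) := by
    simpa [epoch] using ctl_epoch hq hJ hηK hη0.le hη1 T₁ 0
  have hinc := hs.inc x y hxy
  simp only [Pi.smul_apply, smul_eq_mul, ← mul_sub] at hinc
  have hpow0 : 0 ≤ (1 - δ * η / Fintype.card ι) ^ (T₂ * Fintype.card ι) := by
    refine pow_nonneg (sub_nonneg.2 ?_) _
    rw [div_le_one (by linarith)]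
    nlinarith
  have h1 : (1 - δ * η / Fintype.card ι) ^ (T₂ * Fintype.card ι) *
      (op q (sweeps ι η T₁) total y - op q (sweeps ι η T₁) total x) ≤
      1 / 4 * (total y - total x) := by
    refine (mul_le_mul_of_nonneg_left hinc hpow0).trans ?_
    rw [← mul_assoc]
    refine mul_le_mul_of_nonneg_right ?_ (by linarith)
    refine (mul_le_mul_of_nonneg_right hk (by positivity)).trans ?_
    rwa [mul_comm]
  have h2 : ((T₂ * Fintype.card ι : ℕ) : ℝ) * (2 * (1 + T₁ * M + T₂ * M) * κ) ≤ 1 / 4 := by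
    push_cast
    exact hsmall
  unfold epoch
  linarith

end Contraction

section Polynomial

variable {ι : Type*} [DecidableEq ι] [Fintype ι] {A : Type*} [Fintype A]

/-- The monomial of a set of coordinates. -/
noncomputable def monom (T : Finset ι) : (ι → Bool) → ℝ := ind fun x => ∀ c ∈ T, x c = true

lemma monom_eq_one {T : Finset ι} {x : ι → Bool} (h : ∀ c ∈ T, x c = true) : monom T x = 1 := by
  simp only [monom, ind, if_pos h]

lemma monom_eq_zero {T : Finset ι} {x : ι → Bool} {c : ι} (hc : c ∈ T) (h : x c = false) :
    monom T x = 0 := by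
  have : ¬ ∀ c ∈ T, x c = true := fun hall => by simp [hall c hc] at h
  simp only [monom, ind, if_neg this]

lemma monom_nonneg (T : Finset ι) (x : ι → Bool) : 0 ≤ monom T x := ind_nonneg _ _

lemma monom_le_one (T : Finset ι) (x : ι → Bool) : monom T x ≤ 1 := ind_le_one _ _

lemma monom_mono (T : Finset ι) : Monotone (monom T) := fun _ _ hxy =>
  ind_mono fun h c hc => hxy c (h c hc)

lemma monom_update_true (T : Finset ι) (a : ι) (x : ι → Bool) :
    monom T (Function.update x a true) = monom (T.erase a) x := by
  refine le_antisymm (ind_mono fun h c hc => ?_) (ind_mono fun h c hc => ?_)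
  · have := h c (mem_of_mem_erase hc)
    rwa [Function.update_of_ne (ne_of_mem_erase hc)] at this
  · by_cases hca : c = a
    · subst hca; simp
    · rw [Function.update_of_ne hca]
      exact h c (mem_erase.2 ⟨hca, hc⟩)

lemma monom_update_false (T : Finset ι) (a : ι) (x : ι → Bool) :
    monom T (Function.update x a false) = if a ∈ T then 0 else monom T x := by
  split_ifs with ha
  · exact monom_eq_zero ha (by simp)
  · have h : ∀ c ∈ T, Function.update x a false c = x c := fun c hc =>
      Function.update_of_ne (ne_of_mem_of_not_mem hc ha) _ _
    exact le_antisymm (ind_mono fun H c hc => h c hc ▸ H c hc)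
      (ind_mono fun H c hc => (h c hc).trans (H c hc))

lemma monom_increment_le (T : Finset ι) {x y : ι → Bool} (hxy : x ≤ y) :
    monom T y - monom T x ≤ ∑ e ∈ T, (coord e y - coord e x) * monom (T.erase e) y := by
  have hterm : ∀ e ∈ T, 0 ≤ (coord e y - coord e x) * monom (T.erase e) y := fun e _ =>
    mul_nonneg (sub_nonneg.2 (coord_mono e hxy)) (monom_nonneg _ _)
  by_cases hy : ∀ c ∈ T, y c = true
  · by_cases hx : ∀ c ∈ T, x c = true
    · rw [monom_eq_one hx, monom_eq_one hy, sub_self]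
      exact sum_nonneg hterm
    · push Not at hx
      obtain ⟨e, he, hxe⟩ := hx
      refine le_trans ?_ (single_le_sum hterm he)
      have h1 : monom (T.erase e) y = 1 := monom_eq_one fun c hc => hy c (mem_of_mem_erase hc)
      rw [h1, coord, coord, if_pos (hy e he), if_neg hxe, monom_eq_one hy]
      have := monom_nonneg T x
      linarith
  · have : monom T y = 0 := by simp only [monom, ind, if_neg hy]
    rw [this]
    have := monom_nonneg T x
    have := sum_nonneg hterm
    linarith

/-- The polynomial with coefficients `u` and monomials `T`. -/
noncomputable def poly (u : A → ℝ) (T : A → Finset ι) (x : ι → Bool) : ℝ :=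
  ∑ α, u α * monom (T α) x

/-- The coefficients of the partial derivative with respect to `a`. -/
def dcoef (u : A → ℝ) (T : A → Finset ι) (a : ι) (α : A) : ℝ := if a ∈ T α then u α else 0

/-- The monomials of the partial derivative with respect to `a`. -/
def dset (T : A → Finset ι) (a : ι) (α : A) : Finset ι := (T α).erase a

/-- The partial derivative of a polynomial. -/
noncomputable def grad (u : A → ℝ) (T : A → Finset ι) (a : ι) : (ι → Bool) → ℝ :=
  poly (dcoef u T a) (dset T a)

variable {u : A → ℝ} {T : A → Finset ι}

lemma dcoef_nonneg (hu : ∀ α, 0 ≤ u α) (a : ι) (α : A) : 0 ≤ dcoef u T a α := by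
  unfold dcoef; split_ifs <;> simp [hu]

lemma discDeriv_poly (u : A → ℝ) (T : A → Finset ι) (a : ι) (x : ι → Bool) :
    discDeriv a (poly u T) x = grad u T a x := by
  unfold discDeriv grad poly
  rw [← sum_sub_distrib]
  refine sum_congr rfl fun α _ => ?_
  rw [monom_update_true, monom_update_false, dcoef, dset]
  split_ifs with h
  · ring
  · rw [erase_eq_of_notMem h]; ring

lemma poly_nonneg (hu : ∀ α, 0 ≤ u α) (x : ι → Bool) : 0 ≤ poly u T x :=
  sum_nonneg fun α _ => mul_nonneg (hu α) (monom_nonneg _ _)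

lemma poly_le (hu : ∀ α, 0 ≤ u α) (x : ι → Bool) : poly u T x ≤ ∑ α, u α :=
  sum_le_sum fun α _ => mul_le_of_le_one_right (hu α) (monom_le_one _ _)

lemma poly_mono (hu : ∀ α, 0 ≤ u α) : Monotone (poly u T) := fun _ _ hxy =>
  sum_le_sum fun α _ => mul_le_mul_of_nonneg_left (monom_mono _ hxy) (hu α)

lemma grad_mono (hu : ∀ α, 0 ≤ u α) (a : ι) : Monotone (grad u T a) :=
  poly_mono (dcoef_nonneg hu a)

lemma blind_grad (u : A → ℝ) (T : A → Finset ι) (a : ι) : Blind a (grad u T a) := by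
  intro x b
  refine sum_congr rfl fun α _ => ?_
  cases b
  · rw [monom_update_false, if_neg (by simp [dset])]
  · rw [monom_update_true, dset, erase_idem]

lemma poly_increment_le (hu : ∀ α, 0 ≤ u α) {x y : ι → Bool} (hxy : x ≤ y) :
    poly u T y - poly u T x ≤ ∑ e, grad u T e y * (coord e y - coord e x) := by
  unfold grad poly
  rw [← sum_sub_distrib]
  simp only [sum_mul]
  rw [sum_comm]
  refine sum_le_sum fun α _ => ?_
  rw [← mul_sub]
  refine (mul_le_mul_of_nonneg_left (monom_increment_le _ hxy) (hu α)).trans (le_of_eq ?_)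
  rw [mul_sum, ← sum_subset (subset_univ (T α))]
  · refine sum_congr rfl fun e he => ?_
    rw [dcoef, if_pos he, dset]; ring
  · intro e _ he
    rw [dcoef, if_neg he]; ring

lemma mean_bern_poly (r : ι → ℝ) (u : A → ℝ) (T : A → Finset ι) :
    mean (bern r) (poly u T) = ∑ α, u α * ∏ c ∈ T α, r c := by
  have : poly u T = ∑ α, u α • monom (T α) := by
    ext x; simp [poly, Finset.sum_apply]
  rw [this, map_sum]
  refine sum_congr rfl fun α _ => ?_
  rw [map_smul, smul_eq_mul, monom, mean_bern_ind_subset]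

lemma mean_bern_poly_mono (hu : ∀ α, 0 ≤ u α) {r r' : ι → ℝ} (h0 : ∀ a, 0 ≤ r a)
    (h : ∀ a, r a ≤ r' a) : mean (bern r) (poly u T) ≤ mean (bern r') (poly u T) := by
  rw [mean_bern_poly, mean_bern_poly]
  exact sum_le_sum fun α _ => mul_le_mul_of_nonneg_left
    (prod_le_prod (fun c _ => h0 c) fun c _ => h c) (hu α)

lemma mean_bern_const_grad (ρ : ℝ) (a : ι) :
    mean (bern fun _ => ρ) (grad u T a) =
      ∑ α, if a ∈ T α then u α * ρ ^ ((T α).card - 1) else 0 := by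
  rw [grad, mean_bern_poly]
  refine sum_congr rfl fun α _ => ?_
  rw [dcoef, dset, prod_const]
  split_ifs with h
  · rw [card_erase_of_mem h]
  · ring

/-- The mixed partial derivative. -/
noncomputable def hess (u : A → ℝ) (T : A → Finset ι) (a e : ι) : (ι → Bool) → ℝ :=
  grad (dcoef u T a) (dset T a) e

/-- An upper bound on the mixed partial derivative. -/
noncomputable def hessBound (u : A → ℝ) (T : A → Finset ι) (a e : ι) : ℝ :=
  ∑ α, if a ∈ T α ∧ e ∈ T α ∧ a ≠ e then u α else 0

lemma sum_dcoef_dcoef (u : A → ℝ) (T : A → Finset ι) (a e : ι) :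
    ∑ α, dcoef (dcoef u T a) (dset T a) e α = hessBound u T a e := by
  refine sum_congr rfl fun α _ => ?_
  simp only [dcoef, dset, mem_erase, ← ite_and]
  congr 1
  rw [eq_iff_iff]
  tauto

lemma hess_le (hu : ∀ α, 0 ≤ u α) (a e : ι) (x : ι → Bool) :
    hess u T a e x ≤ hessBound u T a e := by
  rw [← sum_dcoef_dcoef]
  exact poly_le (dcoef_nonneg (dcoef_nonneg hu a) e) x

lemma hess_nonneg (hu : ∀ α, 0 ≤ u α) (a e : ι) (x : ι → Bool) : 0 ≤ hess u T a e x :=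
  poly_nonneg (dcoef_nonneg (dcoef_nonneg hu a) e) x

lemma hessBound_nonneg (hu : ∀ α, 0 ≤ u α) (a e : ι) : 0 ≤ hessBound u T a e :=
  sum_nonneg fun α _ => by split_ifs <;> simp [hu]

/-- The sum of a column of the Hessian. -/
noncomputable def hessSum (u : A → ℝ) (T : A → Finset ι) (e : ι) : (ι → Bool) → ℝ :=
  ∑ a, hess u T a e

lemma hessSum_mono (hu : ∀ α, 0 ≤ u α) (e : ι) : Monotone (hessSum u T e) := fun x y hxy => by
  simp only [hessSum, Finset.sum_apply]
  exact sum_le_sum fun a _ => grad_mono (dcoef_nonneg hu a) e hxy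

lemma sum_grad_increment_le (hu : ∀ α, 0 ≤ u α) {x y : ι → Bool} (hxy : x ≤ y) :
    ∑ a, (grad u T a y - grad u T a x) ≤
      ∑ e, hessSum u T e y * (coord e y - coord e x) := by
  refine (sum_le_sum fun a _ => poly_increment_le (dcoef_nonneg hu a) hxy).trans (le_of_eq ?_)
  rw [sum_comm]
  refine sum_congr rfl fun e _ => ?_
  rw [← sum_mul, hessSum, Finset.sum_apply]
  rfl

lemma mean_bern_const_hessSum (ρ : ℝ) (e : ι) :
    mean (bern fun _ => ρ) (hessSum u T e) =
      ∑ α, if e ∈ T α then u α * (((T α).card - 1 : ℕ) * ρ ^ ((T α).card - 2)) else 0 := by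
  rw [hessSum, map_sum]
  simp only [hess, mean_bern_const_grad]
  rw [sum_comm]
  refine sum_congr rfl fun α _ => ?_
  split_ifs with he
  · rw [← sum_subset (subset_univ ((T α).erase e))]
    · rw [← card_erase_of_mem he, ← nsmul_eq_mul, ← sum_const, mul_sum]
      refine sum_congr rfl fun a ha => ?_
      rw [if_pos (by simp [dset, he, (ne_of_mem_erase ha).symm]), dcoef,
        if_pos (mem_of_mem_erase ha), dset, card_erase_of_mem (mem_of_mem_erase ha),
        Nat.sub_sub]
    · intro a _ ha
      by_cases hae : e ∈ dset T a α
      · have hea : a ∉ T α := fun h => ha (mem_erase.2 ⟨fun h' => by simp [dset, h'] at hae, h⟩)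
        rw [dcoef, if_neg hea]; simp
      · rw [if_neg hae]
  · exact sum_eq_zero fun a _ => if_neg fun h => he (mem_of_mem_erase h)

/-- Quantitative bounds on the weights of a polynomial of degree at most `m`. -/
structure Sparse (u : A → ℝ) (T : A → Finset ι) (m D ε : ℝ) : Prop where
  nonneg : ∀ α, 0 ≤ u α
  card_le : ∀ α, ((T α).card : ℝ) ≤ m
  deg : ∀ a, ∑ α, (if a ∈ T α then u α else 0) ≤ D
  pair : ∀ a e, hessBound u T a e ≤ ε

lemma hessBound_comm (a e : ι) : hessBound u T a e = hessBound u T e a := by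
  refine sum_congr rfl fun α _ => ?_
  congr 1
  rw [eq_iff_iff, ne_comm]
  tauto

lemma Sparse.sum_hessBound_le {m D ε : ℝ} (h : Sparse u T m D ε) (hm : 0 ≤ m) (e : ι) :
    ∑ a, hessBound u T a e ≤ m * D := by
  unfold hessBound
  rw [sum_comm]
  calc ∑ α, ∑ a, (if a ∈ T α ∧ e ∈ T α ∧ a ≠ e then u α else 0)
      ≤ ∑ α, m * (if e ∈ T α then u α else 0) := sum_le_sum fun α _ => ?_
    _ ≤ m * D := by rw [← mul_sum]; exact mul_le_mul_of_nonneg_left (h.deg e) hm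
  have hu := h.nonneg α
  split_ifs with he
  · calc ∑ a, (if a ∈ T α ∧ e ∈ T α ∧ a ≠ e then u α else 0)
        ≤ ∑ a, if a ∈ T α then u α else 0 := by
          refine sum_le_sum fun a _ => ?_
          by_cases h1 : a ∈ T α
          · rw [if_pos h1]; split_ifs <;> simp [hu]
          · rw [if_neg (fun H => h1 H.1), if_neg h1]
      _ = (T α).card * u α := by simp [sum_ite_mem]
      _ ≤ m * u α := mul_le_mul_of_nonneg_right (h.card_le α) hu
  · rw [mul_zero]
    exact (sum_eq_zero fun a _ => if_neg fun H => he H.2.1).le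

lemma Sparse.sum_sq_hessBound_le {m D ε : ℝ} (h : Sparse u T m D ε) (hm : 0 ≤ m) (hε : 0 ≤ ε)
    (a : ι) : ∑ e, hessBound u T a e ^ 2 ≤ ε * (m * D) := by
  have := h.sum_hessBound_le hm a
  simp only [hessBound_comm _ a] at this
  refine le_trans ?_ (mul_le_mul_of_nonneg_left this hε)
  rw [mul_sum]
  refine sum_le_sum fun e _ => ?_
  rw [sq]
  exact mul_le_mul_of_nonneg_right (h.pair a e) (hessBound_nonneg h.nonneg a e)

lemma abs_discDeriv_grad_le (hu : ∀ α, 0 ≤ u α) (a e : ι) (x : ι → Bool) :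
    |discDeriv e (grad u T a) x| ≤ hessBound u T a e := by
  rw [grad, discDeriv_poly, ← hess, abs_of_nonneg (hess_nonneg hu a e x)]
  exact hess_le hu a e x

lemma Sparse.abs_discDeriv_hessSum_le {m D ε : ℝ} (h : Sparse u T m D ε)
    (e e' : ι) (x : ι → Bool) :
    |discDeriv e' (hessSum u T e) x| ≤ m * hessBound u T e e' := by
  have h0 := fun a => dcoef_nonneg (T := T) h.nonneg a
  have h1 := fun a => dcoef_nonneg (T := dset T a) (h0 a) e
  have h2 : discDeriv e' (hessSum u T e) x = ∑ a, discDeriv e' (hess u T a e) x := by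
    simp only [discDeriv, hessSum, Finset.sum_apply, sum_sub_distrib]
  have h3 : ∀ a, discDeriv e' (hess u T a e) x =
      hess (dcoef u T a) (dset T a) e e' x := fun a => by
    rw [hess, grad, discDeriv_poly]; rfl
  rw [h2]
  simp only [h3]
  rw [abs_of_nonneg (sum_nonneg fun a _ => hess_nonneg (h0 a) e e' x)]
  refine (sum_le_sum fun a _ => hess_le (h0 a) e e' x).trans ?_
  unfold hessBound
  rw [sum_comm, mul_sum]
  refine sum_le_sum fun α _ => ?_
  have hu := h.nonneg α
  by_cases he : e ∈ T α ∧ e' ∈ T α ∧ e ≠ e'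
  · rw [if_pos he]
    calc _ ≤ ∑ a, (if a ∈ T α then u α else 0) := sum_le_sum fun a _ => by
          split_ifs with H1 H2 <;> simp [dcoef, *]
      _ = (T α).card * u α := by simp [sum_ite_mem]
      _ ≤ m * u α := mul_le_mul_of_nonneg_right (h.card_le α) hu
  · rw [if_neg he, mul_zero]
    refine (sum_eq_zero fun a _ => if_neg fun H => he ?_).le
    exact ⟨mem_of_mem_erase H.1, mem_of_mem_erase H.2.1, H.2.2⟩

lemma Sparse.grad_tail_le {m D ε : ℝ} (h : Sparse u T m D ε) (hm : 1 ≤ m) (hD : 0 < D)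
    (hε : 0 < ε) {σ : ℝ} (hσ : σ = 1 ∨ σ = -1) {r : ι → ℝ} (h0 : ∀ a, 0 ≤ r a)
    (h1 : ∀ a, r a ≤ 1) (a : ι) {t : ℝ} (ht : 0 ≤ t) :
    mean (bern r) (ind fun x => t < σ * (grad u T a x - mean (bern r) (grad u T a))) ≤
      Real.exp (-(t ^ 2 / (2 * (ε * m ^ 3 * D)))) := by
  have key := bern_tail_le h0 h1 (f := σ • grad u T a) (v := hessBound u T a) (fun e x => by
    rw [discDeriv_smul, abs_mul]
    have : |σ| = 1 := by rcases hσ with rfl | rfl <;> norm_num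
    rw [this, one_mul]
    exact abs_discDeriv_grad_le h.nonneg a e x) (B := ε * m ^ 3 * D) (by positivity)
    ((h.sum_sq_hessBound_le (by linarith) hε.le a).trans (by
      have : m ≤ m ^ 3 := le_self_pow₀ hm (by norm_num)
      have := mul_le_mul_of_nonneg_left this (by positivity : 0 ≤ ε * D)
      linarith)) ht
  rw [map_smul] at key
  simpa only [Pi.smul_apply, smul_eq_mul, ← mul_sub] using key

lemma Sparse.hessSum_tail_le {m D ε : ℝ} (h : Sparse u T m D ε) (hm : 1 ≤ m) (hD : 0 < D)
    (hε : 0 < ε) {r : ι → ℝ} (h0 : ∀ a, 0 ≤ r a)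
    (h1 : ∀ a, r a ≤ 1) (e : ι) {t : ℝ} (ht : 0 ≤ t) :
    mean (bern r) (ind fun x => t < hessSum u T e x - mean (bern r) (hessSum u T e)) ≤
      Real.exp (-(t ^ 2 / (2 * (ε * m ^ 3 * D)))) := by
  refine bern_tail_le h0 h1 (fun e' x => h.abs_discDeriv_hessSum_le e e' x) (by positivity) ?_ ht
  simp only [mul_pow, ← mul_sum]
  have := mul_le_mul_of_nonneg_left (h.sum_sq_hessBound_le (by linarith) hε.le e)
    (by positivity : 0 ≤ m ^ 2)
  linarith

end Polynomial

lemma Phi_nonneg (t : ℝ) : 0 ≤ Phi t := by unfold Phi; positivity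

lemma Phi_le_one (t : ℝ) : Phi t ≤ 1 := by
  unfold Phi
  rw [div_le_one (by positivity)]
  linarith

lemma hasDerivAt_Phi (t : ℝ) : HasDerivAt Phi (Phi t * (1 - Phi t)) t := by
  have h : HasDerivAt Phi _ t := (Real.hasDerivAt_exp t).div
    ((Real.hasDerivAt_exp t).const_add 1) (by positivity)
  refine h.congr_deriv ?_
  have : 1 + Real.exp t ≠ 0 := by positivity
  unfold Phi
  field_simp

lemma deriv_Phi (t : ℝ) : deriv Phi t = Phi t * (1 - Phi t) := (hasDerivAt_Phi t).deriv

lemma differentiable_Phi : Differentiable ℝ Phi := fun t => (hasDerivAt_Phi t).differentiableAt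

lemma monotone_Phi : Monotone Phi := monotone_of_deriv_nonneg differentiable_Phi fun t => by
  rw [deriv_Phi]
  exact mul_nonneg (Phi_nonneg t) (sub_nonneg.2 (Phi_le_one t))

lemma Phi_sub_le {lam a b : ℝ} (h : ∀ t ∈ Set.Icc a b, Phi t * (1 - Phi t) ≤ lam)
    (hab : a ≤ b) : Phi b - Phi a ≤ lam * (b - a) :=
  Convex.image_sub_le_mul_sub_of_deriv_le (convex_Icc a b)
    differentiable_Phi.continuous.continuousOn
    differentiable_Phi.differentiableOn (fun t ht => by
      rw [deriv_Phi]; exact h t (interior_subset ht)) a (Set.left_mem_Icc.2 hab) b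
    (Set.right_mem_Icc.2 hab) hab

lemma Phi_sub_le_sub {a b : ℝ} (hab : a ≤ b) : Phi b - Phi a ≤ b - a := by
  have := Phi_sub_le (lam := 1) (a := a) (b := b) (fun t _ => by
    nlinarith [Phi_nonneg t, Phi_le_one t, sq_nonneg (Phi t)]) hab
  linarith

lemma lt_sub_of_Phi {a b γ : ℝ} (hγ : 0 ≤ γ) (h : Phi a + γ < Phi b) : γ < b - a := by
  have hab : a ≤ b := by
    by_contra hba
    have := monotone_Phi (le_of_not_ge hba)
    linarith
  have := Phi_sub_le_sub hab
  linarith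

section Ferromagnet

variable {ι : Type*} [DecidableEq ι] [Fintype ι] {A : Type*} [Fintype A]
  {u : A → ℝ} {T : A → Finset ι}

/-- The heat-bath rates of the Gibbs measure with a polynomial Hamiltonian. -/
noncomputable def gibbsRate (u : A → ℝ) (T : A → Finset ι) (a : ι) (x : ι → Bool) : ℝ :=
  Phi (grad u T a x)

lemma rates_gibbsRate (hu : ∀ α, 0 ≤ u α) : Rates (gibbsRate u T) where
  nonneg _ _ := Phi_nonneg _
  le_one _ _ := Phi_le_one _
  mono a := monotone_Phi.comp (grad_mono hu a)
  blind a x b := by unfold gibbsRate; rw [blind_grad]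

lemma balanced_gibbsRate (Z : ℝ) (a : ι) :
    Balanced (fun x => Real.exp (poly u T x) / Z) (gibbsRate u T a) a := by
  intro x
  unfold gibbsRate Phi
  rw [← discDeriv_poly, discDeriv, Real.exp_sub]
  have h1 := Real.exp_pos (poly u T (Function.update x a true))
  have h2 := Real.exp_pos (poly u T (Function.update x a false))
  field_simp
  ring

lemma influence_gibbsRate {m D ε : ℝ} (h : Sparse u T m D ε) (hm : 0 ≤ m) :
    Influence (gibbsRate u T) (hessBound u T) (m * D) where
  nonneg := hessBound_nonneg h.nonneg
  colSum := h.sum_hessBound_le hm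
  incr a x y hxy := by
    refine (Phi_sub_le_sub (grad_mono h.nonneg a hxy)).trans ?_
    refine (poly_increment_le (dcoef_nonneg h.nonneg a) hxy).trans (sum_le_sum fun e _ => ?_)
    exact mul_le_mul_of_nonneg_right (hess_le h.nonneg a e y) (sub_nonneg.2 (coord_mono e hxy))

lemma mean_ind_exists_le {w : (ι → Bool) → ℝ} (hw : ∀ x, 0 ≤ w x) {P : ι → (ι → Bool) → Prop}
    {κ : ℝ} (h : ∀ a, mean w (ind (P a)) ≤ κ) :
    mean w (ind fun x => ∃ a, P a x) ≤ Fintype.card ι * κ := by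
  have h1 : mean w (ind fun x => ∃ a, P a x) ≤ mean w (∑ a, ind (P a)) := by
    refine mean_mono hw fun x => ?_
    rw [Finset.sum_apply]
    by_cases hx : ∃ a, P a x
    · obtain ⟨a, ha⟩ := hx
      refine le_trans (ind_le_one _ _) (le_trans ?_ (single_le_sum
        (fun b _ => ind_nonneg (P b) x) (mem_univ a)))
      simp [ind, ha]
    · have : ind (fun x => ∃ a, P a x) x = 0 := by simp only [ind, if_neg hx]
      rw [this]
      exact sum_nonneg fun b _ => ind_nonneg (P b) x
  refine h1.trans ?_
  rw [map_sum]
  refine (sum_le_sum fun a _ => h a).trans (le_of_eq ?_)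
  simp

lemma mean_ind_or_le {w : (ι → Bool) → ℝ} (hw : ∀ x, 0 ≤ w x) {P Q : (ι → Bool) → Prop} :
    mean w (ind fun x => P x ∨ Q x) ≤ mean w (ind P) + mean w (ind Q) := by
  rw [← map_add]
  refine mean_mono hw fun x => ?_
  rw [Pi.add_apply]
  have := ind_nonneg P x
  have := ind_nonneg Q x
  by_cases hP : P x
  · have : ind P x = 1 := by simp [ind, hP]
    have := ind_le_one (fun x => P x ∨ Q x) x
    linarith
  · by_cases hQ : Q x
    · have : ind Q x = 1 := by simp [ind, hQ]
      have := ind_le_one (fun x => P x ∨ Q x) x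
      linarith
    · have : ind (fun x => P x ∨ Q x) x = 0 := by simp [ind, hP, hQ]
      linarith

/-- Mean-field description of a polynomial Hamiltonian `poly u T` by a function `Ψ`, together with
the constants expressing that the mean-field dynamics contracts towards `[ρ₀, ρ₁]`. -/
structure MeanField (u : A → ℝ) (T : A → Finset ι) (Ψ : ℝ → ℝ) (ρ₀ ρ₁ γ δ τ : ℝ) : Prop where
  zero_le : 0 ≤ ρ₀
  le_left : ρ₀ ≤ 1
  le_right : 0 ≤ ρ₁
  le_one : ρ₁ ≤ 1
  upper : ∀ a ρ, 0 ≤ ρ → ρ ≤ 1 → mean (bern fun _ => ρ) (grad u T a) ≤ Ψ ρ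
  lower : ∀ a ρ, 0 ≤ ρ → ρ ≤ 1 → Ψ ρ - τ ≤ mean (bern fun _ => ρ) (grad u T a)
  drift_right : ∀ ρ, ρ₁ ≤ ρ → ρ ≤ 1 → Phi (Ψ ρ) + 2 * γ ≤ ρ
  drift_left : ∀ ρ, 0 ≤ ρ → ρ ≤ ρ₀ → ρ + 2 * γ ≤ Phi (Ψ ρ)
  contract : ∃ lam ξ, 0 ≤ lam ∧ lam * ξ ≤ 1 - δ ∧
    (∀ e, mean (bern fun _ => ρ₁) (hessSum u T e) + τ ≤ ξ) ∧
    ∀ t, Ψ ρ₀ - 2 * τ ≤ t → t ≤ Ψ ρ₁ + τ → Phi t * (1 - Phi t) ≤ lam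

lemma MeanField.drift_one {Ψ : ℝ → ℝ} {ρ₀ ρ₁ γ δ τ m D ε : ℝ}
    (h : MeanField u T Ψ ρ₀ ρ₁ γ δ τ) (hs : Sparse u T m D ε) (hm : 1 ≤ m) (hD : 0 < D)
    (hε : 0 < ε) (hτ : 0 ≤ τ) (hτγ : 2 * τ ≤ γ) {ρ : ℝ} (hρ : ρ₁ ≤ ρ) (hρ1 : ρ ≤ 1) :
    Drift (gibbsRate u T) 1 ρ γ (Real.exp (-(τ ^ 2 / (2 * (ε * m ^ 3 * D))))) := by
  have hd := h.drift_right ρ hρ hρ1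
  have hP := Phi_nonneg (Ψ ρ)
  have hρ0 := h.le_right.trans hρ
  refine ⟨hρ0, hρ1, by linarith, by linarith, fun r h0 h1 hr a => ?_⟩
  refine le_trans (mean_mono (bern_nonneg h0 h1) fun x => ind_mono fun hx => ?_)
    (hs.grad_tail_le hm hD hε (Or.inl rfl) h0 h1 a hτ)
  have h2 := h.upper a ρ hρ0 hρ1
  have h3 : mean (bern r) (grad u T a) ≤ mean (bern fun _ => ρ) (grad u T a) :=
    mean_bern_poly_mono (dcoef_nonneg hs.nonneg a) h0 fun e => by simpa using hr e
  have h4 : γ < grad u T a x - Ψ ρ := lt_sub_of_Phi (by linarith) (by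
    change 1 * (ρ - Phi (grad u T a x)) < γ at hx
    linarith)
  linarith

lemma MeanField.drift_neg_one {Ψ : ℝ → ℝ} {ρ₀ ρ₁ γ δ τ m D ε : ℝ}
    (h : MeanField u T Ψ ρ₀ ρ₁ γ δ τ) (hs : Sparse u T m D ε) (hm : 1 ≤ m) (hD : 0 < D)
    (hε : 0 < ε) (hτ : 0 ≤ τ) (hτγ : 2 * τ ≤ γ) {ρ : ℝ} (hρ0 : 0 ≤ ρ) (hρ : ρ ≤ ρ₀) :
    Drift (gibbsRate u T) (-1) ρ γ (Real.exp (-(τ ^ 2 / (2 * (ε * m ^ 3 * D))))) := by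
  have hd := h.drift_left ρ hρ0 hρ
  have hP := Phi_le_one (Ψ ρ)
  have hρ1 := hρ.trans h.le_left
  refine ⟨hρ0, hρ1, by linarith, by linarith, fun r h0 h1 hr a => ?_⟩
  refine le_trans (mean_mono (bern_nonneg h0 h1) fun x => ind_mono fun hx => ?_)
    (hs.grad_tail_le hm hD hε (Or.inr rfl) h0 h1 a hτ)
  have h2 := h.lower a ρ hρ0 hρ1
  have h3 : mean (bern fun _ => ρ) (grad u T a) ≤ mean (bern r) (grad u T a) :=
    mean_bern_poly_mono (dcoef_nonneg hs.nonneg a) (fun _ => hρ0) fun e => by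
      have := hr e; linarith
  have h4 : γ < Ψ ρ - grad u T a x := lt_sub_of_Phi (by linarith) (by
    change -1 * (ρ - Phi (grad u T a x)) < γ at hx
    linarith)
  linarith

lemma Drift.mono_tail {q : ι → (ι → Bool) → ℝ} {σ ρ γ κ κ' : ℝ} (h : Drift q σ ρ γ κ)
    (hκ : κ ≤ κ') : Drift q σ ρ γ κ' :=
  ⟨h.1, h.2, h.3, h.4, fun r h0 h1 hr a => (h.tail r h0 h1 hr a).trans hκ⟩

/-- In the mean-field subcritical regime, an epoch of the dynamics halves Lipschitz constants. -/
lemma MeanField.ctl_epoch {Ψ : ℝ → ℝ} {ρ₀ ρ₁ γ δ τ m D ε η : ℝ}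
    (h : MeanField u T Ψ ρ₀ ρ₁ γ δ τ) (hs : Sparse u T m D ε) (hm : 1 ≤ m) (hD : 0 < D)
    (hε : 0 < ε) (hτ : 0 < τ) (hτγ : 2 * τ ≤ γ) (hδ0 : 0 ≤ δ) (hδ1 : δ ≤ 1)
    (hη0 : 0 < η) (hη1 : η ≤ 1) (hηK : η * (m * D) ≤ 1 / 2) (hcard : 0 < Fintype.card ι)
    {T₁ T₂ : ℕ} (hT₁ : 1 ≤ T₁ * (η * γ)) (hT₂ : 2 ^ T₁ * Real.exp (-(δ * η * T₂)) ≤ 1 / 4)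
    (hsmall : T₂ * Fintype.card ι *
      (2 * (1 + T₁ * Fintype.card ι + T₂ * Fintype.card ι) *
        (Fintype.card ι * (2 * Real.exp (-(τ ^ 2 / (2 * (ε * m ^ 3 * D))))))) ≤ 1 / 4) :
    Ctl (gibbsRate u T) (epoch ι η T₁ T₂) (1 / 2) ((2 ^ (T₁ + T₂) - 1) * (2 * η)) := by
  have hq := rates_gibbsRate (T := T) hs.nonneg
  obtain ⟨lam, ξ, hlam, hlξ, hξ, hwin⟩ := h.contract
  set E := Real.exp (-(τ ^ 2 / (2 * (ε * m ^ 3 * D)))) with hE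
  have hE0 : 0 ≤ E := (Real.exp_pos _).le
  have hM1 : (1 : ℝ) ≤ Fintype.card ι := by exact_mod_cast hcard
  have hEκ : E ≤ Fintype.card ι * (2 * E) := by nlinarith
  have hbern₀ := bern_nonneg (ι := ι) (fun _ => h.zero_le) (fun _ => h.le_left)
  have hbern₁ := bern_nonneg (ι := ι) (fun _ => h.le_right) (fun _ => h.le_one)
  refine ctl_epoch_half hq (influence_gibbsRate hs (by linarith)) (γ := γ)
    (κ := Fintype.card ι * (2 * E)) (δ := δ) (ρ₀ := ρ₀) (ρ₁ := ρ₁)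
    (b₀ := ind fun x => ∃ a, grad u T a x < Ψ ρ₀ - 2 * τ)
    (b₁ := ind fun x => ∃ a, Ψ ρ₁ + τ < grad u T a x ∨ ξ < hessSum u T a x)
    hηK hη0 hη1 hδ0 hδ1 hcard (by linarith) (by positivity) ?_ ?_ ?_ h.zero_le h.le_left
    h.le_right h.le_one
    (fun ρ h0 h1 => (h.drift_neg_one hs hm hD hε hτ.le hτγ h0 h1).mono_tail hEκ)
    (fun ρ h0 h1 => (h.drift_one hs hm hD hε hτ.le hτγ h0 h1).mono_tail hEκ) ?_ ?_ hT₁ hT₂ hsmall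
  · refine ⟨ind_nonneg _, ind_le_one _, fun x y hxy => ?_⟩
    have : ind (fun x => ∃ a, grad u T a x < Ψ ρ₀ - 2 * τ) y ≤
        ind (fun x => ∃ a, grad u T a x < Ψ ρ₀ - 2 * τ) x :=
      ind_mono fun ⟨a, ha⟩ => ⟨a, (grad_mono hs.nonneg a hxy).trans_lt ha⟩
    linarith
  · refine ⟨ind_nonneg _, ind_le_one _, fun x y hxy => ?_⟩
    rw [one_mul, one_mul]
    exact ind_mono fun ⟨a, ha⟩ => ⟨a, ha.imp (fun h => h.trans_le (grad_mono hs.nonneg a hxy))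
      (fun h => h.trans_le (hessSum_mono hs.nonneg a hxy))⟩
  · intro x y hxy
    have htot : 0 ≤ total y - total x := by
      rw [total_apply, total_apply, ← sum_sub_distrib]
      exact sum_nonneg fun e _ => sub_nonneg.2 (coord_mono e hxy)
    have hb : ∑ a, gibbsRate u T a y - ∑ a, gibbsRate u T a x ≤ Fintype.card ι := by
      have h1 : ∑ a, gibbsRate u T a y ≤ ∑ a : ι, (1 : ℝ) :=
        sum_le_sum fun a _ => hq.le_one a y
      have h2 : 0 ≤ ∑ a, gibbsRate u T a x := sum_nonneg fun a _ => hq.nonneg a x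
      simp only [sum_const, card_univ, nsmul_eq_mul, mul_one] at h1
      linarith
    have hi0 := ind_nonneg (fun x => ∃ a, grad u T a x < Ψ ρ₀ - 2 * τ) x
    have hi1 := ind_nonneg (fun x => ∃ a, Ψ ρ₁ + τ < grad u T a x ∨ ξ < hessSum u T a x) y
    have hc : 0 ≤ (1 - δ) * (total y - total x) := mul_nonneg (by linarith) htot
    by_cases hy : ∃ a, Ψ ρ₁ + τ < grad u T a y ∨ ξ < hessSum u T a y
    · have : ind (fun x => ∃ a, Ψ ρ₁ + τ < grad u T a x ∨ ξ < hessSum u T a x) y = 1 := by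
        simp only [ind, if_pos hy]
      rw [this]
      nlinarith
    by_cases hx : ∃ a, grad u T a x < Ψ ρ₀ - 2 * τ
    · have : ind (fun x => ∃ a, grad u T a x < Ψ ρ₀ - 2 * τ) x = 1 := by
        simp only [ind, if_pos hx]
      rw [this]
      nlinarith
    push Not at hx hy
    have h1 : ∑ a, gibbsRate u T a y - ∑ a, gibbsRate u T a x ≤
        lam * ∑ a, (grad u T a y - grad u T a x) := by
      rw [← sum_sub_distrib, mul_sum]
      refine sum_le_sum fun a _ => Phi_sub_le (fun t ht => hwin t ?_ ?_)
        (grad_mono hs.nonneg a hxy)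
      · exact (hx a).trans ht.1
      · exact ht.2.trans (hy a).1
    have h2 : ∑ e, hessSum u T e y * (coord e y - coord e x) ≤ ξ * (total y - total x) := by
      rw [total_apply, total_apply, ← sum_sub_distrib, mul_sum]
      exact sum_le_sum fun e _ => mul_le_mul_of_nonneg_right (hy e).2
        (sub_nonneg.2 (coord_mono e hxy))
    have h3 := mul_le_mul_of_nonneg_left ((sum_grad_increment_le hs.nonneg hxy).trans h2) hlam
    have h4 := mul_le_mul_of_nonneg_right hlξ htot
    have h5 : 0 ≤ (Fintype.card ι : ℝ) *
        (ind (fun x => ∃ a, Ψ ρ₁ + τ < grad u T a x ∨ ξ < hessSum u T a x) y +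
          ind (fun x => ∃ a, grad u T a x < Ψ ρ₀ - 2 * τ) x) :=
      mul_nonneg (by linarith) (add_nonneg hi1 hi0)
    linarith
  · refine mean_ind_exists_le hbern₀ fun a => ?_
    refine le_trans (mean_mono hbern₀ fun x => ind_mono fun hx => ?_)
      ((hs.grad_tail_le hm hD hε (Or.inr rfl) (fun _ => h.zero_le) (fun _ => h.le_left) a
        hτ.le).trans (by linarith : E ≤ 2 * E))
    have := h.lower a ρ₀ h.zero_le h.le_left
    linarith
  · refine mean_ind_exists_le hbern₁ fun a => ?_
    refine (mean_ind_or_le hbern₁).trans ?_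
    have e1 : mean (bern fun _ => ρ₁) (ind fun x => Ψ ρ₁ + τ < grad u T a x) ≤ E := by
      refine le_trans (mean_mono hbern₁ fun x => ind_mono fun hx => ?_)
        (hs.grad_tail_le hm hD hε (Or.inl rfl) (fun _ => h.le_right) (fun _ => h.le_one) a hτ.le)
      have := h.upper a ρ₁ h.le_right h.le_one
      linarith
    have e2 : mean (bern fun _ => ρ₁) (ind fun x => ξ < hessSum u T a x) ≤ E := by
      refine le_trans (mean_mono hbern₁ fun x => ind_mono fun hx => ?_)
        (hs.hessSum_tail_le hm hD hε (fun _ => h.le_right) (fun _ => h.le_one) a hτ.le)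
      have := hξ a
      linarith
    linarith

end Ferromagnet

section Counting

variable {m n : ℕ}

lemma card_embedding_prescribed_le (S : Finset (Fin m)) (g : Fin m → Fin n) :
    #{ψ : Fin m ↪ Fin n | ∀ u ∈ S, ψ u = g u} ≤ n ^ (m - #S) := by
  have h : #{ψ : Fin m ↪ Fin n | ∀ u ∈ S, ψ u = g u} ≤
      #(univ : Finset ({u // u ∉ S} → Fin n)) := by
    refine card_le_card_of_injOn (fun ψ u => ψ u.1) (fun _ _ => by simp) ?_
    intro ψ hψ ψ' hψ' heq
    simp only [coe_filter, mem_univ, true_and, Set.mem_ofPred_eq] at hψ hψ'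
    ext u
    by_cases hu : u ∈ S
    · rw [hψ u hu, hψ' u hu]
    · exact congrArg Fin.val (congrFun heq ⟨u, hu⟩)
  simpa [Fintype.card_subtype_compl] using h

lemma exists_perm_pair {i j i' j' : Fin n} (hij : i ≠ j) (hij' : i' ≠ j') :
    ∃ σ : Equiv.Perm (Fin n), σ i = i' ∧ σ j = j' := by
  refine ⟨(Equiv.swap i i').trans (Equiv.swap (Equiv.swap i i' j) j'), ?_, by simp⟩
  have h : i' ≠ Equiv.swap i i' j := by
    intro h
    have := congrArg (Equiv.swap i i') h
    rw [Equiv.swap_apply_right, Equiv.swap_apply_self] at this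
    exact hij this
  simp only [Equiv.trans_apply, Equiv.swap_apply_left]
  exact Equiv.swap_apply_of_ne_of_ne h hij'

lemma card_embedding_pair_le {u v : Fin m} (huv : u ≠ v) (i j : Fin n) :
    #{ψ : Fin m ↪ Fin n | ψ u = i ∧ ψ v = j} ≤ n ^ (m - 2) := by
  have := card_embedding_prescribed_le {u, v} (fun w => if w = u then i else j)
  rw [card_pair huv] at this
  refine le_trans (card_le_card fun ψ => ?_) this
  simp only [mem_filter, mem_univ, true_and, mem_insert, mem_singleton]
  rintro ⟨h1, h2⟩ w (rfl | rfl)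
  · simpa using h1
  · simpa [huv.symm] using h2

lemma card_embedding_triple_le {u v w : Fin m} (huv : u ≠ v) (huw : u ≠ w) (hvw : v ≠ w)
    (i j k : Fin n) :
    #{ψ : Fin m ↪ Fin n | ψ u = i ∧ ψ v = j ∧ ψ w = k} ≤ n ^ (m - 3) := by
  have := card_embedding_prescribed_le {u, v, w}
    (fun z => if z = u then i else if z = v then j else k)
  rw [card_eq_three.2 ⟨u, v, w, huv, huw, hvw, rfl⟩] at this
  refine le_trans (card_le_card fun ψ => ?_) this
  simp only [mem_filter, mem_univ, true_and, mem_insert, mem_singleton]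
  rintro ⟨h1, h2, h3⟩ z (rfl | rfl | rfl)
  · simpa using h1
  · simpa [huv.symm] using h2
  · simpa [huw.symm, hvw.symm] using h3

lemma descFactorial_le_card_embedding_pair {u v : Fin m} (huv : u ≠ v) {i j : Fin n}
    (hij : i ≠ j) :
    n.descFactorial m ≤ n ^ 2 * #{ψ : Fin m ↪ Fin n | ψ u = i ∧ ψ v = j} := by
  have hsym : ∀ p : Fin n × Fin n,
      #{ψ : Fin m ↪ Fin n | (ψ u, ψ v) = p} ≤ #{ψ : Fin m ↪ Fin n | ψ u = i ∧ ψ v = j} := by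
    rintro ⟨i', j'⟩
    by_cases h : i' = j'
    · subst h
      refine le_trans (le_of_eq (card_eq_zero.2 (filter_eq_empty_iff.2 ?_))) (Nat.zero_le _)
      intro ψ _ h
      rw [Prod.mk.injEq] at h
      exact huv (ψ.injective (h.1.trans h.2.symm))
    obtain ⟨σ, hi, hj⟩ := exists_perm_pair h hij
    refine card_le_card_of_injOn (fun ψ => ψ.trans σ.toEmbedding) (fun ψ hψ => ?_) ?_
    · simp only [coe_filter, mem_univ, true_and, Set.mem_ofPred_eq, Prod.mk.injEq] at hψ ⊢
      simp [hψ.1, hψ.2, hi, hj]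
    · intro ψ _ ψ' _ heq
      ext w
      exact congrArg Fin.val (σ.injective (DFunLike.congr_fun heq w))
  calc n.descFactorial m = #(univ : Finset (Fin m ↪ Fin n)) := by
        rw [card_univ, Fintype.card_embedding_eq, Fintype.card_fin, Fintype.card_fin]
    _ = ∑ p : Fin n × Fin n, #{ψ : Fin m ↪ Fin n | (ψ u, ψ v) = p} :=
        card_eq_sum_card_fiberwise fun _ _ => mem_coe.2 (mem_univ _)
    _ ≤ ∑ _p : Fin n × Fin n, #{ψ : Fin m ↪ Fin n | ψ u = i ∧ ψ v = j} :=
        sum_le_sum fun p _ => hsym p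
    _ = _ := by simp [sq]

open scoped Classical in
/-- The edges of the copy of `G` placed by `ψ`. -/
noncomputable def copyEdges (G : SimpleGraph (Fin m)) (ψ : Fin m ↪ Fin n) :
    Finset (EdgeSet n) :=
  {e | ∃ a b, G.Adj a b ∧ s(ψ a, ψ b) = e.1}

lemma mem_copyEdges {G : SimpleGraph (Fin m)} {ψ : Fin m ↪ Fin n} {e : EdgeSet n} :
    e ∈ copyEdges G ψ ↔ ∃ a b, G.Adj a b ∧ s(ψ a, ψ b) = e.1 := by
  simp [copyEdges]

lemma mem_copyEdges_pair {G : SimpleGraph (Fin m)} {ψ : Fin m ↪ Fin n} {e : EdgeSet n}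
    {i j : Fin n} (he : e.1 = s(i, j)) :
    e ∈ copyEdges G ψ ↔ ∃ a b, G.Adj a b ∧ ψ a = i ∧ ψ b = j := by
  rw [mem_copyEdges]
  constructor
  · rintro ⟨a, b, hab, h⟩
    rw [he, Sym2.eq_iff] at h
    rcases h with h | h
    · exact ⟨a, b, hab, h⟩
    · exact ⟨b, a, hab.symm, h.2, h.1⟩
  · rintro ⟨a, b, hab, rfl, rfl⟩
    exact ⟨a, b, hab, he.symm⟩

open scoped Classical in
lemma card_copyEdges (G : SimpleGraph (Fin m)) (ψ : Fin m ↪ Fin n) :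
    #(copyEdges G ψ) = numEdges G := by
  have h : (copyEdges G ψ).map (Function.Embedding.subtype _) =
      G.edgeFinset.image (Sym2.map ψ) := by
    ext p
    simp only [Finset.mem_map, mem_copyEdges, Function.Embedding.coe_subtype, mem_image,
      SimpleGraph.mem_edgeFinset]
    constructor
    · rintro ⟨e, ⟨a, b, hab, h⟩, rfl⟩
      exact ⟨s(a, b), hab, by rw [← h]; rfl⟩
    · rintro ⟨q, hq, rfl⟩
      induction q with | _ a b =>
      have hab : G.Adj a b := hq
      exact ⟨⟨s(ψ a, ψ b), by simpa using hab.ne⟩, ⟨a, b, hab, rfl⟩, rfl⟩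
  rw [← card_map, h, card_image_of_injective _ (Sym2.map.injective ψ.injective), numEdges,
    Set.ncard_eq_toFinset_card', SimpleGraph.edgeFinset]

lemma NG_eq_sum_monom (G : SimpleGraph (Fin m)) (x : Config n) :
    NG G x = ∑ ψ : Fin m ↪ Fin n, monom (copyEdges G ψ) x := by
  classical
  refine sum_congr rfl fun ψ _ => ?_
  have hval : ∀ {a b} (hab : G.Adj a b), edgeVal x (ψ a) (ψ b) =
      x ⟨s(ψ a, ψ b), by simpa using hab.ne⟩ := fun {a b} hab => by
    rw [edgeVal, dif_neg]
  by_cases h : ∀ e ∈ copyEdges G ψ, x e = true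
  · rw [monom_eq_one h]
    refine prod_eq_one fun a _ => prod_eq_one fun b _ => ?_
    split_ifs with hab
    · rw [edgeInd, hval hab, if_pos (h _ (mem_copyEdges.2 ⟨a, b, hab, rfl⟩))]
    · rfl
  · push Not at h
    obtain ⟨e, he, hx⟩ := h
    have hx' : x e = false := by simpa using hx
    rw [monom_eq_zero he hx']
    obtain ⟨a, b, hab, hs⟩ := mem_copyEdges.1 he
    refine prod_eq_zero (mem_univ a) (prod_eq_zero (mem_univ b) ?_)
    rw [if_pos hab, edgeInd, hval hab, if_neg]
    simp only [hs]
    simpa using hx'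

open scoped Classical in
lemma card_copyEdges_fiber (G : SimpleGraph (Fin m)) {e : EdgeSet n} {i j : Fin n}
    (he : e.1 = s(i, j)) :
    #{ψ : Fin m ↪ Fin n | e ∈ copyEdges G ψ} =
      ∑ p : Fin m × Fin m with G.Adj p.1 p.2, #{ψ : Fin m ↪ Fin n | ψ p.1 = i ∧ ψ p.2 = j} := by
  rw [← card_biUnion]
  · congr 1
    ext ψ
    simp [mem_copyEdges_pair he]
  · intro p _ q _ hpq
    rw [Function.onFun, disjoint_left]
    intro ψ h1 h2
    simp only [mem_filter, mem_univ, true_and] at h1 h2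
    exact hpq (Prod.ext (ψ.injective (h1.1.trans h2.1.symm)) (ψ.injective (h1.2.trans h2.2.symm)))

open scoped Classical in
lemma card_adj_pairs (G : SimpleGraph (Fin m)) :
    #{p : Fin m × Fin m | G.Adj p.1 p.2} = 2 * numEdges G := by
  rw [numEdges, Set.ncard_eq_toFinset_card', ← SimpleGraph.edgeFinset,
    SimpleGraph.two_mul_card_edgeFinset]

lemma exists_pair_rep (e : EdgeSet n) : ∃ i j, i ≠ j ∧ e.1 = s(i, j) := by
  obtain ⟨q, hq⟩ := e
  induction q with | _ i j =>
  exact ⟨i, j, by simpa using hq, rfl⟩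

open scoped Classical in
lemma card_copyEdges_fiber_le (G : SimpleGraph (Fin m)) (e : EdgeSet n) :
    #{ψ : Fin m ↪ Fin n | e ∈ copyEdges G ψ} ≤ 2 * numEdges G * n ^ (m - 2) := by
  obtain ⟨i, j, -, he⟩ := exists_pair_rep e
  rw [card_copyEdges_fiber G he, ← card_adj_pairs, ← smul_eq_mul]
  refine sum_le_card_nsmul _ _ _ fun p hp => ?_
  exact card_embedding_pair_le (mem_filter.1 hp).2.ne i j

open scoped Classical in
lemma le_card_copyEdges_fiber (G : SimpleGraph (Fin m)) (e : EdgeSet n) :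
    2 * numEdges G * n.descFactorial m ≤
      n ^ 2 * #{ψ : Fin m ↪ Fin n | e ∈ copyEdges G ψ} := by
  obtain ⟨i, j, hij, he⟩ := exists_pair_rep e
  rw [card_copyEdges_fiber G he, ← card_adj_pairs, ← smul_eq_mul, mul_sum]
  refine card_nsmul_le_sum _ _ _ fun p hp => ?_
  exact descFactorial_le_card_embedding_pair (mem_filter.1 hp).2.ne hij

lemma exists_mem_not_mem {a e : EdgeSet n} (hae : a ≠ e) : ∃ k ∈ e.1, k ∉ a.1 := by
  by_contra! h
  obtain ⟨i, j, hij, he⟩ := exists_pair_rep e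
  refine hae (Subtype.ext ?_)
  rw [he] at h ⊢
  exact (Sym2.mem_and_mem_iff hij).1 ⟨h i (by simp), h j (by simp)⟩

open scoped Classical in
lemma card_copyEdges_fiber_two_le (G : SimpleGraph (Fin m)) {a e : EdgeSet n} (hae : a ≠ e) :
    n * #{ψ : Fin m ↪ Fin n | a ∈ copyEdges G ψ ∧ e ∈ copyEdges G ψ} ≤ m ^ 3 * n ^ (m - 2) := by
  obtain ⟨i, j, hij, ha⟩ := exists_pair_rep a
  obtain ⟨k, hke, hka⟩ := exists_mem_not_mem hae
  rw [ha, Sym2.mem_iff, not_or] at hka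
  have hsub : ({ψ : Fin m ↪ Fin n | a ∈ copyEdges G ψ ∧ e ∈ copyEdges G ψ} : Finset _) ⊆
      (univ : Finset (Fin m × Fin m × Fin m)).biUnion fun p =>
        {ψ : Fin m ↪ Fin n | ψ p.1 = i ∧ ψ p.2.1 = j ∧ ψ p.2.2 = k} := by
    intro ψ hψ
    simp only [mem_filter, mem_univ, true_and] at hψ
    obtain ⟨u, v, -, hu, hv⟩ := (mem_copyEdges_pair ha).1 hψ.1
    obtain ⟨b, c, -, hbc⟩ := mem_copyEdges.1 hψ.2
    rw [← hbc, Sym2.mem_iff] at hke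
    obtain ⟨w, hw⟩ : ∃ w, ψ w = k := by
      rcases hke with h | h
      · exact ⟨b, h.symm⟩
      · exact ⟨c, h.symm⟩
    exact mem_biUnion.2 ⟨(u, v, w), mem_univ _, by simp [hu, hv, hw]⟩
  have hcard : ∀ p : Fin m × Fin m × Fin m,
      n * #{ψ : Fin m ↪ Fin n | ψ p.1 = i ∧ ψ p.2.1 = j ∧ ψ p.2.2 = k} ≤ n ^ (m - 2) := by
    rintro ⟨u, v, w⟩
    by_cases hne : u ≠ v ∧ u ≠ w ∧ v ≠ w
    · have hm : 3 ≤ m := by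
        have := Finset.card_le_univ ({u, v, w} : Finset (Fin m))
        rwa [card_eq_three.2 ⟨u, v, w, hne.1, hne.2.1, hne.2.2, rfl⟩, Fintype.card_fin] at this
      calc _ ≤ n * n ^ (m - 3) := Nat.mul_le_mul_left _
            (card_embedding_triple_le hne.1 hne.2.1 hne.2.2 i j k)
        _ = n ^ (m - 2) := by rw [← pow_succ']; congr 1; omega
    · refine le_trans (le_of_eq ?_) (Nat.zero_le _)
      rw [mul_eq_zero, card_eq_zero, filter_eq_empty_iff]
      right
      rintro ψ - ⟨h1, h2, h3⟩
      refine hne ⟨?_, ?_, ?_⟩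
      · rintro rfl; exact hij (h1.symm.trans h2)
      · rintro rfl; exact hka.1 (h3.symm.trans h1)
      · rintro rfl; exact hka.2 (h3.symm.trans h2)
  calc _ ≤ n * ∑ p : Fin m × Fin m × Fin m,
        #{ψ : Fin m ↪ Fin n | ψ p.1 = i ∧ ψ p.2.1 = j ∧ ψ p.2.2 = k} :=
        Nat.mul_le_mul_left _ ((card_le_card hsub).trans card_biUnion_le)
    _ ≤ ∑ _p : Fin m × Fin m × Fin m, n ^ (m - 2) := by
        rw [mul_sum]; exact sum_le_sum fun p _ => hcard p
    _ = _ := by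
        rw [sum_const, card_univ, smul_eq_mul]
        simp only [Fintype.card_prod, Fintype.card_fin]
        ring

end Counting

section Subcritical

open Topology

lemma Phi_pos (t : ℝ) : 0 < Phi t := by unfold Phi; positivity

lemma Phi_lt_one (t : ℝ) : Phi t < 1 := by
  unfold Phi
  rw [div_lt_one (by positivity)]
  linarith

lemma exists_pos_lower_bound {f : ℝ → ℝ} (hf : Continuous f) {a b c : ℝ} (hc : c ∈ Set.Icc a b)
    (hfc : 0 < f c) (hne : ∀ x ∈ Set.Icc a b, f x ≠ 0) :
    ∃ γ, 0 < γ ∧ ∀ x ∈ Set.Icc a b, 2 * γ ≤ f x := by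
  have hpos : ∀ x ∈ Set.Icc a b, 0 < f x := fun x hx => by
    by_contra! h
    obtain ⟨y, hy, hy0⟩ := isPreconnected_Icc.intermediate_value hx hc hf.continuousOn ⟨h, hfc.le⟩
    exact hne y hy hy0
  obtain ⟨x, hx, hmin⟩ := isCompact_Icc.exists_isMinOn ⟨c, hc⟩ hf.continuousOn
  exact ⟨f x / 2, half_pos (hpos x hx), fun y hy => by
    have := isMinOn_iff.1 hmin y hy
    linarith⟩

variable {s : ℕ} (V : Fin s → ℕ) (G : ∀ i, SimpleGraph (Fin (V i))) (β : Fin s → ℝ)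

/-- The derivative of `Psi`. -/
noncomputable def dPsi (p : ℝ) : ℝ :=
  ∑ i, 2 * β i * (numEdges (G i) : ℝ) * ((numEdges (G i) - 1 : ℕ) * p ^ (numEdges (G i) - 2))

lemma hasDerivAt_Psi (p : ℝ) : HasDerivAt (Psi V G β) (dPsi V G β p) p :=
  HasDerivAt.fun_sum fun i _ => (hasDerivAt_pow (numEdges (G i) - 1) p).const_mul _

lemma continuous_Psi : Continuous (Psi V G β) := by
  unfold Psi
  fun_prop

lemma continuous_dPsi : Continuous (dPsi V G β) := by
  unfold dPsi
  fun_prop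

lemma continuous_Phi : Continuous Phi := differentiable_Phi.continuous

lemma dPsi_nonneg (hβ : ∀ i, 0 < β i) {q : ℝ} (hq : 0 ≤ q) : 0 ≤ dPsi V G β q :=
  sum_nonneg fun i _ => by have := hβ i; positivity

lemma Psi_nonneg (hβ : ∀ i, 0 < β i) {q : ℝ} (hq : 0 ≤ q) : 0 ≤ Psi V G β q :=
  sum_nonneg fun i _ => by have := hβ i; positivity

lemma Psi_le_Psi_one (hβ : ∀ i, 0 < β i) {q : ℝ} (hq : 0 ≤ q) (hq1 : q ≤ 1) :
    Psi V G β q ≤ Psi V G β 1 :=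
  sum_le_sum fun i _ => by
    have := hβ i
    rw [one_pow]
    exact mul_le_mul_of_nonneg_left (pow_le_one₀ hq hq1) (by positivity)

/-- A window around the fixed point outside of which the mean-field map has uniform drift and
inside of which it contracts with rate `1 - δ`. -/
structure Window (ρ₀ ρ₁ γ δ τ : ℝ) : Prop where
  zero_le : 0 ≤ ρ₀
  le_left : ρ₀ ≤ 1
  le_right : 0 ≤ ρ₁
  le_one : ρ₁ ≤ 1
  gap_pos : 0 < γ
  rate_pos : 0 < δ
  rate_le : δ ≤ 1
  slack_pos : 0 < τ
  slack_le : 2 * τ ≤ γ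
  drift_right : ∀ ρ, ρ₁ ≤ ρ → ρ ≤ 1 → Phi (Psi V G β ρ) + 2 * γ ≤ ρ
  drift_left : ∀ ρ, 0 ≤ ρ → ρ ≤ ρ₀ → ρ + 2 * γ ≤ Phi (Psi V G β ρ)
  contract : ∃ lam ξ, 0 ≤ lam ∧ lam * ξ ≤ 1 - δ ∧ dPsi V G β ρ₁ + τ ≤ ξ ∧
    ∀ t, Psi V G β ρ₀ - 2 * τ ≤ t → t ≤ Psi V G β ρ₁ + τ → Phi t * (1 - Phi t) ≤ lam

variable {V G β} in
lemma Subcritical.mul_dPsi_lt_one {p : ℝ} (h : Subcritical V G β p) :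
    Phi (Psi V G β p) * (1 - Phi (Psi V G β p)) * dPsi V G β p < 1 := by
  have hd : HasDerivAt (phiFn V G β) _ p :=
    (hasDerivAt_Phi (Psi V G β p)).comp p (hasDerivAt_Psi V G β p)
  have := h.2.2
  rwa [hd.deriv] at this

variable {V G β} in
lemma Subcritical.exists_window {p : ℝ} (h : Subcritical V G β p) (hβ : ∀ i, 0 < β i) :
    ∃ ρ₀ ρ₁ γ δ τ, Window V G β ρ₀ ρ₁ γ δ τ := by
  obtain ⟨hfix, huniq, -⟩ := id h
  have hfix' : Phi (Psi V G β p) = p := hfix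
  have hp0 : 0 < p := hfix' ▸ Phi_pos _
  have hp1 : p < 1 := hfix' ▸ Phi_lt_one _
  set L : ℝ → ℝ := fun t => Phi t * (1 - Phi t) with hL
  have hLc : Continuous L := continuous_Phi.mul (continuous_const.sub continuous_Phi)
  have hLnn : ∀ t, 0 ≤ L t := fun t =>
    mul_nonneg (Phi_nonneg t) (sub_nonneg.2 (Phi_le_one t))
  set t₀ := Psi V G β p with ht₀
  obtain ⟨ε, hε, hε0⟩ : ∃ ε, (L t₀ + ε) * (dPsi V G β p + 2 * ε) < 1 ∧ 0 < ε := by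
    have hc : Continuous fun ε : ℝ => (L t₀ + ε) * (dPsi V G β p + 2 * ε) := by fun_prop
    have hlt : (L t₀ + 0) * (dPsi V G β p + 2 * 0) < 1 := by
      simpa using h.mul_dPsi_lt_one
    have hev : ∀ᶠ ε in 𝓝[>] (0 : ℝ), (L t₀ + ε) * (dPsi V G β p + 2 * ε) < 1 :=
      nhdsWithin_le_nhds (hc.continuousAt.eventually_lt continuousAt_const hlt)
    exact (hev.and self_mem_nhdsWithin).exists
  obtain ⟨w, hw0, hw⟩ : ∃ w > 0, ∀ t, |t - t₀| < w → L t < L t₀ + ε := by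
    have := Metric.eventually_nhds_iff.1
      (hLc.continuousAt.eventually_lt continuousAt_const (by linarith : L t₀ < L t₀ + ε))
    obtain ⟨w, hw0, hw⟩ := this
    exact ⟨w, hw0, fun t ht => hw ht⟩
  obtain ⟨r, ⟨⟨⟨h1, h2⟩, h3⟩, h4, h5⟩, hr0⟩ : ∃ r, (((Psi V G β (p + r) < t₀ + w / 2 ∧
      t₀ - w / 2 < Psi V G β (p - r)) ∧ dPsi V G β (p + r) < dPsi V G β p + ε) ∧
      p + r < 1 ∧ 0 < p - r) ∧ 0 < r := by
    have hP := continuous_Psi V G β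
    have hdP := continuous_dPsi V G β
    have e1 : ∀ᶠ r in 𝓝 (0 : ℝ), Psi V G β (p + r) < t₀ + w / 2 :=
      (by fun_prop : Continuous fun r => Psi V G β (p + r)).continuousAt.eventually_lt
        continuousAt_const (by simp only [add_zero]; linarith)
    have e2 : ∀ᶠ r in 𝓝 (0 : ℝ), t₀ - w / 2 < Psi V G β (p - r) :=
      continuousAt_const.eventually_lt
        (by fun_prop : Continuous fun r => Psi V G β (p - r)).continuousAt
        (by simp only [sub_zero]; linarith)
    have e3 : ∀ᶠ r in 𝓝 (0 : ℝ), dPsi V G β (p + r) < dPsi V G β p + ε :=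
      (by fun_prop : Continuous fun r => dPsi V G β (p + r)).continuousAt.eventually_lt
        continuousAt_const (by simp only [add_zero]; linarith)
    have e4 : ∀ᶠ r in 𝓝 (0 : ℝ), p + r < 1 :=
      (by fun_prop : Continuous fun r => p + r).continuousAt.eventually_lt
        continuousAt_const (by simpa)
    have e5 : ∀ᶠ r in 𝓝 (0 : ℝ), 0 < p - r :=
      continuousAt_const.eventually_lt
        (by fun_prop : Continuous fun r => p - r).continuousAt (by simpa)
    have hall : ∀ᶠ r in 𝓝[>] (0 : ℝ), _ :=
      nhdsWithin_le_nhds (((e1.and e2).and e3).and (e4.and e5))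
    exact (hall.and self_mem_nhdsWithin).exists
  have hφ : Continuous fun ρ => Phi (Psi V G β ρ) := continuous_Phi.comp (continuous_Psi V G β)
  obtain ⟨γ₁, hγ₁, hR⟩ := exists_pos_lower_bound (a := p + r) (b := 1)
    (f := fun ρ => ρ - Phi (Psi V G β ρ)) (continuous_id.sub hφ) (Set.right_mem_Icc.2 h4.le)
    (sub_pos.2 (Phi_lt_one _)) (fun x hx h0 => by
      have := huniq x (sub_eq_zero.1 h0).symm
      linarith [hx.1])
  obtain ⟨γ₀, hγ₀, hLeft⟩ := exists_pos_lower_bound (a := 0) (b := p - r)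
    (f := fun ρ => Phi (Psi V G β ρ) - ρ) (hφ.sub continuous_id) (Set.left_mem_Icc.2 h5.le)
    (by simpa using Phi_pos _) (fun x hx h0 => by
      have := huniq x (sub_eq_zero.1 h0)
      linarith [hx.2])
  set γ := min γ₀ γ₁ with hγ
  have hγpos : 0 < γ := lt_min hγ₀ hγ₁
  set τ := min (min ε (w / 8)) (γ / 2) with hτ
  have hτpos : 0 < τ := lt_min (lt_min hε0 (by linarith)) (by linarith)
  have hτε : τ ≤ ε := (min_le_left _ _).trans (min_le_left _ _)
  have hτw : τ ≤ w / 8 := (min_le_left _ _).trans (min_le_right _ _)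
  have hτγ : τ ≤ γ / 2 := min_le_right _ _
  have hprod : 0 ≤ (L t₀ + ε) * (dPsi V G β p + 2 * ε) :=
    mul_nonneg (by linarith [hLnn t₀]) (by linarith [dPsi_nonneg V G β hβ hp0.le])
  refine ⟨p - r, p + r, γ, 1 - (L t₀ + ε) * (dPsi V G β p + 2 * ε), τ, h5.le, by linarith,
    by linarith, h4.le, hγpos, by linarith, by linarith, hτpos, by linarith, ?_, ?_, ?_⟩
  · intro ρ h1 h2
    have := hR ρ ⟨h1, h2⟩
    have := min_le_right γ₀ γ₁
    linarith
  · intro ρ h1 h2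
    have := hLeft ρ ⟨h1, h2⟩
    have := min_le_left γ₀ γ₁
    linarith
  · refine ⟨L t₀ + ε, dPsi V G β p + 2 * ε, by linarith [hLnn t₀], by linarith, by linarith,
      fun t ht1 ht2 => (hw t ?_).le⟩
    rw [abs_lt]
    constructor <;> linarith

end Subcritical

section Ergm

variable {s : ℕ} (V : Fin s → ℕ) (G : ∀ i, SimpleGraph (Fin (V i))) (β : Fin s → ℝ) (n : ℕ)

/-- The index set of the monomials of the Hamiltonian. -/
abbrev CopyIndex : Type := Σ i : Fin s, (Fin (V i) ↪ Fin n)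

/-- The coefficients of the Hamiltonian. -/
noncomputable def copyWeight (α : CopyIndex V n) : ℝ := β α.1 / (n : ℝ) ^ (V α.1 - 2)

/-- The edge sets of the monomials of the Hamiltonian. -/
noncomputable def copySupport (α : CopyIndex V n) : Finset (EdgeSet n) := copyEdges (G α.1) α.2

/-- The normalised number of copies of `G` through an edge. -/
noncomputable def copyDensity {n m : ℕ} (G : SimpleGraph (Fin m)) (e : EdgeSet n) : ℝ :=
  (#{ψ : Fin m ↪ Fin n | e ∈ copyEdges G ψ} : ℝ) / (n : ℝ) ^ (m - 2)

variable {V G β n}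

lemma Hamiltonian_eq_poly (x : Config n) :
    Hamiltonian V G β x = poly (copyWeight V β n) (copySupport V G n) x := by
  rw [poly, Fintype.sum_sigma]
  refine sum_congr rfl fun i _ => ?_
  rw [NG_eq_sum_monom, mul_sum, sum_div]
  refine sum_congr rfl fun ψ _ => ?_
  simp only [copyWeight, copySupport]
  ring

lemma sum_copyWeight (g : Fin s → ℝ) (e : EdgeSet n) :
    ∑ α, (if e ∈ copySupport V G n α then copyWeight V β n α * g α.1 else 0) =
      ∑ i, β i * g i * copyDensity (G i) e := by
  rw [Fintype.sum_sigma]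
  refine sum_congr rfl fun i _ => ?_
  change ∑ ψ : Fin (V i) ↪ Fin n, (if e ∈ copyEdges (G i) ψ then
    β i / (n : ℝ) ^ (V i - 2) * g i else 0) = _
  rw [copyDensity, ← sum_filter, sum_const, nsmul_eq_mul]
  ring

lemma pos_of_edge (e : EdgeSet n) : 0 < n := by
  obtain ⟨i, -⟩ := exists_pair_rep e
  exact i.pos

lemma copyDensity_le {m : ℕ} (G : SimpleGraph (Fin m)) (e : EdgeSet n) :
    copyDensity G e ≤ 2 * numEdges G := by
  have hn := pos_of_edge e
  rw [copyDensity, div_le_iff₀ (by positivity)]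
  exact_mod_cast card_copyEdges_fiber_le G e

lemma two_le_of_numEdges_ne_zero {m : ℕ} {G : SimpleGraph (Fin m)} (h : numEdges G ≠ 0) :
    2 ≤ m := by
  classical
  have h2 : #{p : Fin m × Fin m | G.Adj p.1 p.2} ≠ 0 := by
    rw [card_adj_pairs]
    omega
  obtain ⟨p, hp⟩ := card_ne_zero.1 h2
  have := (mem_filter.1 hp).2.ne
  by_contra hm
  exact this (Fin.ext (by omega))

lemma le_copyDensity {m : ℕ} (G : SimpleGraph (Fin m)) (e : EdgeSet n) :
    2 * numEdges G * ((n.descFactorial m : ℝ) / (n : ℝ) ^ m) ≤ copyDensity G e := by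
  have hn := pos_of_edge e
  have hn' : (0 : ℝ) < n := by exact_mod_cast hn
  by_cases h0 : numEdges G = 0
  · rw [h0, copyDensity]
    simp only [Nat.cast_zero, mul_zero, zero_mul]
    positivity
  have hm := two_le_of_numEdges_ne_zero h0
  have h := le_card_copyEdges_fiber G e
  have h' : (2 * numEdges G * n.descFactorial m : ℝ) ≤
      n ^ 2 * #{ψ : Fin m ↪ Fin n | e ∈ copyEdges G ψ} := by exact_mod_cast h
  rw [copyDensity, mul_div_assoc', div_le_div_iff₀ (by positivity) (by positivity)]
  have hp : (n : ℝ) ^ m = n ^ 2 * n ^ (m - 2) := by rw [← pow_add]; congr 1; omega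
  rw [hp]
  calc _ ≤ ((n : ℝ) ^ 2 * #{ψ : Fin m ↪ Fin n | e ∈ copyEdges G ψ}) * n ^ (m - 2) := by gcongr
    _ = _ := by ring

variable (V G) in
/-- A bound on the degree of the Hamiltonian. -/
noncomputable def degBound : ℝ := 1 + ∑ i, (numEdges (G i) : ℝ)

variable (V β) in
/-- A bound on the scale of the mixed derivatives of the Hamiltonian. -/
noncomputable def pairBound : ℝ := 1 + ∑ i, β i * (V i : ℝ) ^ 3

lemma card_copySupport (α : CopyIndex V n) : #(copySupport V G n α) = numEdges (G α.1) :=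
  card_copyEdges _ _

lemma hessBound_copy_le (hβ : ∀ i, 0 < β i) (a e : EdgeSet n) :
    hessBound (copyWeight V β n) (copySupport V G n) a e ≤ pairBound V β / n := by
  have hn := pos_of_edge e
  have hn' : (0 : ℝ) < n := by exact_mod_cast hn
  have hC : ∑ i, β i * (V i : ℝ) ^ 3 ≤ pairBound V β := by
    rw [pairBound]; linarith
  have hC0 : 0 ≤ ∑ i, β i * (V i : ℝ) ^ 3 := sum_nonneg fun i _ => by
    have := hβ i; positivity
  by_cases hae : a = e
  · subst hae
    rw [hessBound, sum_eq_zero fun α _ => if_neg fun h => h.2.2 rfl]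
    exact div_nonneg (hC0.trans hC) hn'.le
  rw [le_div_iff₀ hn']
  refine le_trans ?_ hC
  rw [hessBound, Fintype.sum_sigma, sum_mul]
  refine sum_le_sum fun i _ => ?_
  change (∑ ψ : Fin (V i) ↪ Fin n, if a ∈ copyEdges (G i) ψ ∧ e ∈ copyEdges (G i) ψ ∧ a ≠ e then
    β i / (n : ℝ) ^ (V i - 2) else 0) * (n : ℝ) ≤ _
  rw [← sum_filter, sum_const, nsmul_eq_mul]
  have h := card_copyEdges_fiber_two_le (G i) hae
  have h' : (n : ℝ) * #{ψ : Fin (V i) ↪ Fin n | a ∈ copyEdges (G i) ψ ∧ e ∈ copyEdges (G i) ψ} ≤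
      V i ^ 3 * n ^ (V i - 2) := by exact_mod_cast h
  simp only [ne_eq, hae, not_false_eq_true, and_true]
  rw [mul_div_assoc', div_mul_eq_mul_div, div_le_iff₀ (by positivity)]
  nlinarith [mul_le_mul_of_nonneg_left h' (hβ i).le]

lemma sparse_copy (hβ : ∀ i, 0 < β i) :
    Sparse (copyWeight V β n) (copySupport V G n) (degBound V G) (1 + Psi V G β 1)
      (pairBound V β / n) where
  nonneg α := div_nonneg (hβ α.1).le (by positivity)
  card_le α := by
    rw [card_copySupport, degBound]
    have := single_le_sum (f := fun i => (numEdges (G i) : ℝ)) (fun i _ => by positivity)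
      (mem_univ α.1)
    linarith
  deg a := by
    have h := sum_copyWeight (V := V) (G := G) (β := β) (fun _ => 1) a
    simp only [mul_one] at h
    rw [h]
    have : ∑ i, β i * copyDensity (G i) a ≤ Psi V G β 1 := sum_le_sum fun i _ => by
      have := mul_le_mul_of_nonneg_left (copyDensity_le (G i) a) (hβ i).le
      rw [one_pow]
      linarith
    linarith
  pair := hessBound_copy_le hβ

lemma mean_grad_copy (ρ : ℝ) (a : EdgeSet n) :
    mean (bern fun _ => ρ) (grad (copyWeight V β n) (copySupport V G n) a) =
      ∑ i, β i * ρ ^ (numEdges (G i) - 1) * copyDensity (G i) a := by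
  rw [mean_bern_const_grad, ← sum_copyWeight]
  simp only [card_copySupport]

lemma mean_hessSum_copy (ρ : ℝ) (e : EdgeSet n) :
    mean (bern fun _ => ρ) (hessSum (copyWeight V β n) (copySupport V G n) e) =
      ∑ i, β i * ((numEdges (G i) - 1 : ℕ) * ρ ^ (numEdges (G i) - 2)) *
        copyDensity (G i) e := by
  rw [mean_bern_const_hessSum, ← sum_copyWeight]
  simp only [card_copySupport]

lemma mean_hessSum_copy_le (hβ : ∀ i, 0 < β i) {ρ : ℝ} (hρ : 0 ≤ ρ) (e : EdgeSet n) :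
    mean (bern fun _ => ρ) (hessSum (copyWeight V β n) (copySupport V G n) e) ≤
      dPsi V G β ρ := by
  rw [mean_hessSum_copy]
  refine sum_le_sum fun i _ => ?_
  have := hβ i
  refine (mul_le_mul_of_nonneg_left (copyDensity_le (G i) e) (by positivity)).trans
    (le_of_eq (by ring))

lemma mean_grad_copy_le (hβ : ∀ i, 0 < β i) {ρ : ℝ} (hρ : 0 ≤ ρ) (a : EdgeSet n) :
    mean (bern fun _ => ρ) (grad (copyWeight V β n) (copySupport V G n) a) ≤ Psi V G β ρ := by
  rw [mean_grad_copy]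
  refine sum_le_sum fun i _ => ?_
  have := hβ i
  refine (mul_le_mul_of_nonneg_left (copyDensity_le (G i) a) (by positivity)).trans
    (le_of_eq (by ring))

lemma le_mean_grad_copy (hβ : ∀ i, 0 < β i) {κ τ : ℝ} (hκ0 : 0 ≤ κ) (hκ : κ * Psi V G β 1 ≤ τ)
    (hn : ∀ i, 1 - κ ≤ (n.descFactorial (V i) : ℝ) / (n : ℝ) ^ V i)
    {ρ : ℝ} (hρ : 0 ≤ ρ) (hρ1 : ρ ≤ 1) (a : EdgeSet n) :
    Psi V G β ρ - τ ≤
      mean (bern fun _ => ρ) (grad (copyWeight V β n) (copySupport V G n) a) := by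
  have h1 : (1 - κ) * Psi V G β ρ ≤
      mean (bern fun _ => ρ) (grad (copyWeight V β n) (copySupport V G n) a) := by
    rw [mean_grad_copy, Psi, mul_sum]
    refine sum_le_sum fun i _ => ?_
    have := hβ i
    have h2 := (mul_le_mul_of_nonneg_left (hn i)
      (by positivity : 0 ≤ 2 * (numEdges (G i) : ℝ))).trans (le_copyDensity (G i) a)
    refine (le_of_eq (by ring)).trans (mul_le_mul_of_nonneg_left h2 (by positivity :
      0 ≤ β i * ρ ^ (numEdges (G i) - 1)))
  have h2 := mul_le_mul_of_nonneg_left (Psi_le_Psi_one V G β hβ hρ hρ1) hκ0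
  linarith

lemma eventually_descFactorial_ge (V : Fin s → ℕ) {κ : ℝ} (hκ : 0 < κ) :
    ∀ᶠ n : ℕ in atTop, ∀ i, 1 - κ ≤ (n.descFactorial (V i) : ℝ) / (n : ℝ) ^ V i := by
  rw [eventually_all]
  intro i
  have h := isEquivalent_descFactorial (V i)
  have hne : ∀ᶠ n : ℕ in atTop, ((n : ℝ) ^ V i) ≠ 0 := by
    filter_upwards [eventually_gt_atTop 0] with n hn
    positivity
  have ht := (Asymptotics.isEquivalent_iff_tendsto_one hne).1 h
  exact (ht.eventually_const_le (by linarith : 1 - κ < 1)).mono fun n hn => hn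

lemma Window.meanField {ρ₀ ρ₁ γ δ τ κ : ℝ} (h : Window V G β ρ₀ ρ₁ γ δ τ) (hβ : ∀ i, 0 < β i)
    (hκ0 : 0 ≤ κ) (hκ : κ * Psi V G β 1 ≤ τ)
    (hn : ∀ i, 1 - κ ≤ (n.descFactorial (V i) : ℝ) / (n : ℝ) ^ V i) :
    MeanField (copyWeight V β n) (copySupport V G n) (Psi V G β) ρ₀ ρ₁ γ δ τ where
  zero_le := h.zero_le
  le_left := h.le_left
  le_right := h.le_right
  le_one := h.le_one
  upper a ρ h0 _ := mean_grad_copy_le hβ h0 a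
  lower a ρ h0 h1 := le_mean_grad_copy hβ hκ0 hκ hn h0 h1 a
  drift_right := h.drift_right
  drift_left := h.drift_left
  contract := by
    obtain ⟨lam, ξ, hlam, hlξ, hξ, ht⟩ := h.contract
    refine ⟨lam, ξ, hlam, hlξ, fun e => ?_, ht⟩
    linarith [mean_hessSum_copy_le (V := V) (G := G) (n := n) hβ h.le_right e]

lemma eventually_poly_mul_exp_le (T₁ T₂ : ℕ) {c : ℝ} (hc : 0 < c) :
    ∀ᶠ n : ℕ in atTop, ∀ M : ℝ, 0 ≤ M → M ≤ (n : ℝ) ^ 2 →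
      T₂ * M * (2 * (1 + T₁ * M + T₂ * M) * (M * (2 * Real.exp (-(c * n))))) ≤ 1 / 4 := by
  have h := ((tendsto_rpow_mul_exp_neg_mul_atTop_nhds_zero 6 c hc).comp
    tendsto_natCast_atTop_atTop).const_mul ((T₂ : ℝ) * 2 * (1 + T₁ + T₂) * 2)
  rw [mul_zero] at h
  filter_upwards [h.eventually_le_const (by norm_num : (0 : ℝ) < 1 / 4),
    eventually_ge_atTop 1] with n hn hn1 M hM0 hM
  refine le_trans ?_ hn
  have h1 : (1 : ℝ) ≤ (n : ℝ) ^ 2 := one_le_pow₀ (by exact_mod_cast hn1)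
  have h2 : 1 + T₁ * M + T₂ * M ≤ (1 + T₁ + T₂) * (n : ℝ) ^ 2 := by
    have := mul_le_mul_of_nonneg_left hM (Nat.cast_nonneg T₁ : (0 : ℝ) ≤ T₁)
    have := mul_le_mul_of_nonneg_left hM (Nat.cast_nonneg T₂ : (0 : ℝ) ≤ T₂)
    linarith
  calc _ ≤ T₂ * (n : ℝ) ^ 2 * (2 * ((1 + T₁ + T₂) * (n : ℝ) ^ 2) *
        ((n : ℝ) ^ 2 * (2 * Real.exp (-(c * n))))) := by gcongr
    _ = _ := by
        have : (n : ℝ) ^ (6 : ℝ) = (n : ℝ) ^ (6 : ℕ) := by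
          rw [← Real.rpow_natCast]; norm_num
        simp only [Function.comp, this, neg_mul]
        ring

lemma card_edgeSet_le (n : ℕ) : Fintype.card (EdgeSet n) ≤ n ^ 2 := by
  rw [Sym2.card_subtype_not_diag, Fintype.card_fin]
  exact Nat.choose_le_pow n 2

lemma card_edgeSet_pos {n : ℕ} (hn : 2 ≤ n) : 0 < Fintype.card (EdgeSet n) :=
  Fintype.card_pos_iff.2 ⟨⟨s(⟨0, by omega⟩, ⟨1, by omega⟩), by simp⟩⟩

end Ergm

section Concentration

variable {n : ℕ}

lemma prob_eq_mean (w : Config n → ℝ) (A : Config n → Prop) : prob w A = mean w (ind A) := by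
  simp only [prob, mean_apply, ind, mul_ite, mul_one, mul_zero]

lemma LipschitzVec.abs_discDeriv_le {v : EdgeSet n → ℝ} (hv : ∀ e, 0 ≤ v e) {f : Config n → ℝ}
    (h : LipschitzVec v f) (a : EdgeSet n) (x : Config n) : |discDeriv a f x| ≤ v a := by
  refine (h _ _).trans ?_
  rw [sum_eq_single a]
  · split_ifs
    exacts [le_rfl, hv a]
  · intro e _ he
    simp [Function.update_of_ne he]
  · simp

lemma LipschitzVec.neg {v : EdgeSet n → ℝ} {f : Config n → ℝ} (h : LipschitzVec v f) :
    LipschitzVec v (-f) := fun x y => by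
  have := h x y
  rwa [Pi.neg_apply, Pi.neg_apply, ← neg_sub', abs_neg]

lemma LipschitzVec.incLe {v : EdgeSet n → ℝ} {d : ℝ} (hvd : ∀ e, v e ≤ d) {f : Config n → ℝ}
    (h : LipschitzVec v f) : IncLe f (d • total) := by
  intro x y hxy
  refine ((le_abs_self _).trans (h y x)).trans ?_
  rw [Pi.smul_apply, Pi.smul_apply, total_apply, total_apply, smul_eq_mul, smul_eq_mul, ← mul_sub,
    ← sum_sub_distrib, mul_sum]
  refine sum_le_sum fun e _ => ?_
  have hle := hxy e
  unfold coord
  cases hx : x e <;> cases hy : y e <;> rw [hx, hy] at hle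
  · simp
  · simpa using hvd e
  · exact absurd (hle rfl) (by simp)
  · simp

lemma LipschitzVec.lipC {v : EdgeSet n → ℝ} {d : ℝ} (hvd : ∀ e, v e ≤ d) {f : Config n → ℝ}
    (h : LipschitzVec v f) : LipC d f := ⟨h.incLe hvd, h.neg.incLe hvd⟩

variable {s : ℕ} {V : Fin s → ℕ} {G : ∀ i, SimpleGraph (Fin (V i))} {β : Fin s → ℝ}

lemma ergmProb_nonneg (x : Config n) : 0 ≤ ergmProb V G β x := by
  unfold ergmProb
  positivity

lemma sum_ergmProb : ∑ x : Config n, ergmProb V G β x = 1 := by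
  unfold ergmProb
  rw [← sum_div]
  exact div_self (sum_pos (fun x _ => Real.exp_pos _) univ_nonempty).ne'

lemma balanced_ergmProb (a : EdgeSet n) :
    Balanced (ergmProb V G β) (gibbsRate (copyWeight V β n) (copySupport V G n) a) a := by
  have h : ergmProb V G β = fun x : Config n =>
      Real.exp (poly (copyWeight V β n) (copySupport V G n) x) /
        ∑ y : Config n, Real.exp (Hamiltonian V G β y) := by
    funext x
    rw [ergmProb, Hamiltonian_eq_poly x]
  rw [h]
  exact balanced_gibbsRate _ a

lemma prob_le_one (A : Config n → Prop) : prob (ergmProb V G β) A ≤ 1 := by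
  rw [prob_eq_mean, mean_apply, ← sum_ergmProb (V := V) (G := G) (β := β) (n := n)]
  exact sum_le_sum fun x _ => mul_le_of_le_one_right (ergmProb_nonneg x) (ind_le_one _ _)

lemma Subcritical.eventually_ctl {p : ℝ} (h : Subcritical V G β p) (hβ : ∀ i, 0 < β i) :
    ∃ A, 0 < A ∧ ∀ᶠ n : ℕ in atTop, ∃ l,
      Ctl (gibbsRate (copyWeight V β n) (copySupport V G n)) l (1 / 2) A := by
  obtain ⟨ρ₀, ρ₁, γ, δ, τ, hw⟩ := h.exists_window hβ
  have hγ := hw.gap_pos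
  have hδ := hw.rate_pos
  have hτ := hw.slack_pos
  have hΨ := Psi_nonneg V G β hβ zero_le_one
  have hm : 1 ≤ degBound V G := by
    have : 0 ≤ ∑ i, (numEdges (G i) : ℝ) := sum_nonneg fun i _ => by positivity
    rw [degBound]
    linarith
  have hC : 0 < pairBound V β := by
    have : 0 ≤ ∑ i, β i * (V i : ℝ) ^ 3 := sum_nonneg fun i _ => by
      have := hβ i
      positivity
    rw [pairBound]
    linarith
  set m := degBound V G
  set D := 1 + Psi V G β 1 with hD
  have hD0 : 0 < D := by linarith
  have hmD : 1 ≤ m * D := one_le_mul_of_one_le_of_one_le hm (by linarith)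
  set η := 1 / (2 * (m * D)) with hη
  have hη0 : 0 < η := by positivity
  have hηK : η * (m * D) ≤ 1 / 2 := by
    rw [hη]
    field_simp
    exact le_rfl
  have hη1 : η ≤ 1 := by nlinarith
  obtain ⟨T₁, hT₁⟩ : ∃ T₁ : ℕ, 1 ≤ T₁ * (η * γ) := by
    obtain ⟨k, hk⟩ := exists_nat_ge (1 / (η * γ))
    exact ⟨k, by rwa [div_le_iff₀ (by positivity)] at hk⟩
  obtain ⟨T₂, hT₂⟩ : ∃ T₂ : ℕ, 2 ^ T₁ * Real.exp (-(δ * η * T₂)) ≤ 1 / 4 := by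
    have ht : Tendsto (fun k : ℕ => 2 ^ T₁ * Real.exp (-(δ * η * k))) atTop (nhds (2 ^ T₁ * 0)) :=
      (Real.tendsto_exp_neg_atTop_nhds_zero.comp
        (tendsto_natCast_atTop_atTop.const_mul_atTop (by positivity))).const_mul _
    rw [mul_zero] at ht
    exact (ht.eventually_le_const (by norm_num : (0 : ℝ) < 1 / 4)).exists
  have hT₁0 : T₁ ≠ 0 := by
    rintro rfl
    norm_num at hT₁
  have hpow : (1 : ℝ) < 2 ^ (T₁ + T₂) := one_lt_pow₀ one_lt_two (by omega)
  refine ⟨(2 ^ (T₁ + T₂) - 1) * (2 * η), mul_pos (by linarith) (by linarith), ?_⟩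
  have hc : 0 < τ ^ 2 / (2 * (pairBound V β * m ^ 3 * D)) := by positivity
  filter_upwards [eventually_descFactorial_ge V (by positivity : 0 < τ / D),
    eventually_poly_mul_exp_le T₁ T₂ hc, eventually_ge_atTop 2] with n hn1 hn2 hn3
  have hn0 : (0 : ℝ) < n := by
    have : 0 < n := by omega
    exact_mod_cast this
  have hκ : τ / D * Psi V G β 1 ≤ τ := by
    rw [div_mul_eq_mul_div, div_le_iff₀ hD0]
    exact mul_le_mul_of_nonneg_left (by linarith) hτ.le
  have hmf := hw.meanField hβ (by positivity) hκ hn1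
  refine ⟨_, hmf.ctl_epoch (sparse_copy hβ) hm hD0 (by positivity) hτ hw.slack_le hδ.le
    hw.rate_le hη0 hη1 hηK (card_edgeSet_pos hn3) hT₁ hT₂ ?_⟩
  have hexp : τ ^ 2 / (2 * (pairBound V β / n * m ^ 3 * D)) =
      τ ^ 2 / (2 * (pairBound V β * m ^ 3 * D)) * n := by
    field_simp
  rw [hexp]
  exact hn2 _ (by positivity) (by exact_mod_cast card_edgeSet_le n)

lemma prob_abs_le_of_ctl (hβ : ∀ i, 0 < β i) {A : ℝ} (hA : 0 < A) {l : List (EdgeSet n → ℝ)}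
    (hl : Ctl (gibbsRate (copyWeight V β n) (copySupport V G n)) l (1 / 2) A)
    {v : EdgeSet n → ℝ} (hv : ∀ e, 0 ≤ v e) {f : Config n → ℝ} (hf : LipschitzVec v f)
    {t : ℝ} (ht : 0 ≤ t) :
    prob (ergmProb V G β) (fun x => t < |f x - expect (ergmProb V G β) f|) ≤
      2 * Real.exp (-(1 / (4 * A) * t ^ 2) / ((∑ e, v e) * ⨆ e, v e)) := by
  set d := ⨆ e, v e with hd
  have hvd : ∀ e, v e ≤ d := fun e => le_ciSup (Set.finite_range v).bddAbove e
  have hd0 : 0 ≤ d := Real.iSup_nonneg hv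
  have hs0 : 0 ≤ ∑ e, v e := sum_nonneg fun e _ => hv e
  rcases (mul_nonneg hs0 hd0).eq_or_lt with h0 | hpos
  · rw [← h0, div_zero, Real.exp_zero]
    exact (prob_le_one _).trans (by norm_num)
  set w : Config n → ℝ := ergmProb V G β with hw
  have hq : Rates (gibbsRate (copyWeight V β n) (copySupport V G n)) :=
    rates_gibbsRate (sparse_copy (G := G) hβ).nonneg
  have hw0 : ∀ x, 0 ≤ w x := ergmProb_nonneg
  have hB0 : 0 < (∑ e, v e) * (2 * A * d) := by
    have : (∑ e, v e) * (2 * A * d) = 2 * A * ((∑ e, v e) * d) := by ring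
    rw [this]
    positivity
  have key : ∀ g : Config n → ℝ, LipschitzVec v g →
      mean w (ind fun x => t < g x - mean w g) ≤
        Real.exp (-(t ^ 2 / (2 * ((∑ e, v e) * (2 * A * d))))) := fun g hg =>
    hl.tail_le hq hA.le hw0 sum_ergmProb balanced_ergmProb hd0 (hg.abs_discDeriv_le hv)
      (hg.lipC hvd) hB0 le_rfl ht
  have hE : -(1 / (4 * A) * t ^ 2) / ((∑ e, v e) * d) =
      -(t ^ 2 / (2 * ((∑ e, v e) * (2 * A * d)))) := by
    rw [neg_div]
    congr 1
    rw [one_div_mul_eq_div, div_div]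
    congr 1
    ring
  rw [prob_eq_mean, hE, two_mul]
  refine le_trans ?_ (add_le_add (key f hf) (key (-f) hf.neg))
  rw [← map_add]
  refine mean_mono hw0 fun x => ?_
  have h1 := ind_nonneg (fun x => t < f x - mean w f) x
  have h2 := ind_nonneg (fun x => t < (-f) x - mean w (-f)) x
  rw [Pi.add_apply]
  by_cases hx : t < |f x - expect w f|
  · refine (ind_le_one _ _).trans ?_
    rcases lt_abs.1 hx with h | h
    · have : ind (fun x => t < f x - mean w f) x = 1 := if_pos h
      linarith
    · have : ind (fun x => t < (-f) x - mean w (-f)) x = 1 := if_pos (by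
        rw [map_neg]
        change t < -f x - -expect w f
        linarith)
      linarith
  · have : ind (fun x => t < |f x - expect w f|) x = 0 := if_neg hx
    rw [this]
    linarith

end Concentration

/-- **Theorem (Gaussian concentration for Lipschitz functions).**
If `β` is sub-critical, there is a constant `c > 0` such that for all sufficiently
large `n`, every nonnegative vector `v`, every `f ∈ Lip(v)` and every `t ≥ 0`,
`ℙ(|f(X) - 𝔼 f(X)| > t) ≤ 2 exp(-c t² / (‖v‖₁ ‖v‖_∞))` where `X ~ ERGM(β)`. -/
theorem gaussian_concentration {s : ℕ} (V : Fin s → ℕ) (G : ∀ i, SimpleGraph (Fin (V i)))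
    (β : Fin s → ℝ) (hβ : ∀ i, 0 < β i) (p : ℝ) (hsub : Subcritical V G β p) :
    ∃ c : ℝ, 0 < c ∧ ∃ N : ℕ, ∀ n : ℕ, N ≤ n →
      ∀ v : EdgeSet n → ℝ, (∀ e, 0 ≤ v e) →
      ∀ f : Config n → ℝ, LipschitzVec v f →
      ∀ t : ℝ, 0 ≤ t →
        prob (ergmProb V G β)
            (fun x => t < |f x - expect (ergmProb V G β) f|) ≤
          2 * Real.exp (-(c * t ^ 2) / ((∑ e : EdgeSet n, v e) * (⨆ e : EdgeSet n, v e))) := by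
  obtain ⟨A, hA, hev⟩ := hsub.eventually_ctl hβ
  obtain ⟨N, hN⟩ := eventually_atTop.1 hev
  refine ⟨1 / (4 * A), by positivity, N, fun n hn v hv f hf t ht => ?_⟩
  obtain ⟨l, hl⟩ := hN n hn
  exact prob_abs_le_of_ctl hβ hA hl hv hf ht

end ERGM
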